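/- arXiv:2412.13792 — 3 statements merged into one kernel-verified Lean document; each statement's English description precedes it below -/
import Mathlib

section
/- Under the setup, every nontrivial component H of the induced subgraph G*[U] satisfies γ(H) ≤ 0. -/
open SimpleGraph Finset
open scoped Classical

/-- The spectral radius of a finite simple graph: the largest eigenvalue of its
adjacency matrix (expressed as the supremum of the set of eigenvalues). -/
noncomputable def specRad {V : Type*} [Fintype V] (G : SimpleGraph V) : ℝ :=
  sSup {t : ℝ | Module.End.HasEigenvalue (Matrix.toLin' (G.adjMatrix ℝ)) t}

/-- The fan graph `F₆ = K₁ ∨ P₅`: the path `0-1-2-3-4` together with the hub `5`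
adjacent to all of `0,…,4`. -/
def fan6 : SimpleGraph (Fin 6) :=
  SimpleGraph.fromRel (fun a b => b = 5 ∨ (b.val = a.val + 1 ∧ b.val ≤ 4))

/-- A graph is `F₆`-free if it contains no subgraph isomorphic to the fan `F₆`,
i.e. there is no injective graph homomorphism from `F₆` into it. -/
def F6Free {V : Type*} (G : SimpleGraph V) : Prop :=
  ¬ ∃ f : fan6 →g G, Function.Injective f

/-- The join `K₂ ∨ kK₁`: two adjacent vertices, each adjacent to `k` further
pairwise non-adjacent vertices. -/
def K2JoinEmpty (k : ℕ) : SimpleGraph (Fin 2 ⊕ Fin k) :=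
  SimpleGraph.fromRel (fun a b => a.isLeft ∨ b.isLeft)

/-- `dS G S v` is the number of neighbors of `v` lying in `S`. -/
noncomputable def dS {V : Type*} (G : SimpleGraph V) (S : Set V) (v : V) : ℕ :=
  (G.neighborSet v ∩ S).ncard

/-- `eIn G S` is the number of edges of the induced subgraph `G[S]`. -/
noncomputable def eIn {V : Type*} (G : SimpleGraph V) (S : Set V) : ℕ :=
  {e ∈ G.edgeSet | ∀ v ∈ e, v ∈ S}.ncard

/-- `eBetween G S T` is the number of edges with one endpoint in `S` and the
other in `T`. -/
noncomputable def eBetween {V : Type*} (G : SimpleGraph V) (S T : Set V) : ℕ :=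
  {e ∈ G.edgeSet | ∃ a ∈ S, ∃ b ∈ T, e = s(a, b)}.ncard

/-- `gamma G x ustar S = Σ_{u∈S} (d_S(u) - 1)·x_u/x_{u*} - e(S)`. -/
noncomputable def gamma {V : Type*} [Fintype V] (G : SimpleGraph V) (x : V → ℝ)
    (ustar : V) (S : Set V) : ℝ :=
  (∑ u ∈ S.toFinset, ((dS G S u : ℝ) - 1) * (x u / x ustar)) - eIn G S

/-- The star `K_{1,r}` with center `0` and `r` leaves. -/
def starGraph (r : ℕ) : SimpleGraph (Fin (r + 1)) :=
  SimpleGraph.fromRel (fun a _ => a = 0)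

/-- `K_{1,r} + e`: the star with center `0` and `r` leaves, plus an edge joining
the two leaves `1` and `2`. -/
def starPlusEdge (r : ℕ) : SimpleGraph (Fin (r + 1)) :=
  SimpleGraph.fromRel (fun a b => a = 0 ∨ (a = 1 ∧ b = 2))

/-- The double star `D_{a,b}`: centers `0` and `1` joined by an edge, `0` joined
to the `a` leaves `2,…,a+1`, and `1` joined to the `b` leaves `a+2,…,a+b+1`. -/
def doubleStar (a b : ℕ) : SimpleGraph (Fin (a + b + 2)) :=
  SimpleGraph.fromRel (fun u v =>
    (u.val = 0 ∧ v.val = 1) ∨ (u.val = 0 ∧ 2 ≤ v.val ∧ v.val < a + 2) ∨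
      (u.val = 1 ∧ a + 2 ≤ v.val))

/-- `K₄ - e`: the complete graph on 4 vertices minus the edge `{0,1}`. -/
def K4MinusE : SimpleGraph (Fin 4) :=
  SimpleGraph.fromRel (fun u v => ¬(u = 0 ∧ v = 1) ∧ ¬(u = 1 ∧ v = 0))

theorem F6Free.no_fan {V : Type*} {G : SimpleGraph V} (hfree : F6Free G) {h a b c d e : V}
    (hnd : [a, b, c, d, e].Nodup)
    (ha : G.Adj h a) (hb : G.Adj h b) (hc : G.Adj h c) (hd : G.Adj h d) (he : G.Adj h e)
    (hab : G.Adj a b) (hbc : G.Adj b c) (hcd : G.Adj c d) (hde : G.Adj d e) : False := by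
  have h1 := ha.ne
  have h2 := hb.ne
  have h3 := hc.ne
  have h4 := hd.ne
  have h5 := he.ne
  simp only [List.nodup_cons, List.mem_cons, List.not_mem_nil, not_or, or_false] at hnd
  refine hfree ⟨⟨![a, b, c, d, e, h], ?_⟩, ?_⟩
  · intro i j hij
    simp only [fan6, SimpleGraph.fromRel_adj] at hij
    fin_cases i <;> fin_cases j <;> simp_all [SimpleGraph.adj_comm]
  · intro i j hij
    change ![a, b, c, d, e, h] i = ![a, b, c, d, e, h] j at hij
    fin_cases i <;> fin_cases j <;> simp_all

/-- Splitting a sum over a closed neighbourhood and its complement. -/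
theorem sum_split_neighbors {V : Type*} [Fintype V] {G : SimpleGraph V} (r : V) (g : V → ℝ) :
    ∑ v, g v = g r + ∑ v with G.Adj r v, g v + ∑ v with (v ≠ r ∧ ¬ G.Adj r v), g v := by
  have h1 := Finset.sum_filter_add_sum_filter_not univ (fun v => G.Adj r v) g
  have h2 := Finset.sum_filter_add_sum_filter_not (univ.filter fun v => ¬ G.Adj r v)
    (fun v => v = r) g
  rw [Finset.filter_filter, Finset.filter_filter] at h2
  have h3 : (univ.filter fun v => ¬ G.Adj r v ∧ v = r) = {r} := by
    ext v
    simp only [Finset.mem_filter, Finset.mem_univ, true_and, Finset.mem_singleton]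
    exact ⟨fun h => h.2, fun h => by subst h; simp⟩
  rw [h3, Finset.sum_singleton] at h2
  simp only [and_comm, ne_eq] at h2 ⊢
  linarith

theorem far_vertices_weight_bound {V : Type*} [Fintype V] (G : SimpleGraph V) (A : V → V → ℝ)
    (hA : ∀ v w, A v w = if G.Adj v w then 1 else 0) (m : ℝ)
    (hm : ∑ v, ∑ w, A v w = 2 * m) (lam : ℝ) (hlow : m ≤ lam ^ 2 - lam + 1) (x : V → ℝ)
    (hx : ∀ v, 0 ≤ x v) (heig : ∀ v, ∑ w, A v w * x w = lam * x v) (r : V) (hr : 0 < x r)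
    (hmax : ∀ v, x v ≤ x r) (P : Finset V)
    (hP : ∀ p ∈ P, G.Adj r p ∧ ∃ q, G.Adj r q ∧ G.Adj p q) :
    lam * ∑ w with (w ≠ r ∧ ¬ G.Adj r w), x w ≤ (m + 1 - 2 * P.card) * x r := by
  set U := univ.filter fun v => G.Adj r v with hU
  set W := univ.filter fun v => v ≠ r ∧ ¬ G.Adj r v with hW
  have hsplit : ∀ g : V → ℝ, ∑ v, g v = g r + ∑ v ∈ U, g v + ∑ v ∈ W, g v :=
    fun g => sum_split_neighbors r g
  have hsymm : ∀ v w, A v w = A w v := fun v w => by simp only [hA, G.adj_comm]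
  have hpos : ∀ v w, 0 ≤ A v w := fun v w => by rw [hA]; split_ifs <;> norm_num
  have hrr : A r r = 0 := by simp [hA]
  have hrU : ∀ u ∈ U, A r u = 1 := fun u hu => by
    rw [hA, if_pos (Finset.mem_filter.1 hu).2]
  have hrW : ∀ w ∈ W, A r w = 0 := fun w hw => by
    rw [hA, if_neg (Finset.mem_filter.1 hw).2.2]
  have hUr : ∀ u ∈ U, A u r = 1 := fun u hu => by rw [hsymm, hrU u hu]
  have hWr : ∀ u ∈ W, A u r = 0 := fun u hu => by rw [hsymm, hrW u hu]
  have eig_r : lam * x r = ∑ u ∈ U, x u := by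
    rw [← heig, hsplit, hrr, Finset.sum_congr rfl fun u hu => by rw [hrU u hu, one_mul],
      Finset.sum_eq_zero (s := W) fun w hw => by rw [hrW w hw, zero_mul]]
    ring
  have eig_U : ∑ u ∈ U, lam * x u =
      U.card * x r + ∑ u ∈ U, (∑ v ∈ U, A u v) * x u + ∑ w ∈ W, (∑ v ∈ U, A w v) * x w := by
    rw [Finset.sum_congr rfl fun u hu => by rw [← heig, hsplit, hUr u hu, one_mul]]
    rw [Finset.sum_add_distrib, Finset.sum_add_distrib, Finset.sum_const, nsmul_eq_mul,
      Finset.sum_comm (t := U), Finset.sum_comm (t := W)]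
    simp only [Finset.sum_mul]
    simp only [fun u v => hsymm u v]
  have eig_W : ∑ w ∈ W, lam * x w ≤
      (∑ w ∈ W, ∑ v ∈ U, A w v + ∑ w ∈ W, ∑ v ∈ W, A w v) * x r := by
    rw [← Finset.sum_add_distrib, Finset.sum_mul]
    refine Finset.sum_le_sum fun w hw => ?_
    rw [← heig, hsplit, hWr w hw, zero_mul, zero_add, add_mul, Finset.sum_mul, Finset.sum_mul]
    exact add_le_add (Finset.sum_le_sum fun v _ => mul_le_mul_of_nonneg_left (hmax v) (hpos _ _))
      (Finset.sum_le_sum fun v _ => mul_le_mul_of_nonneg_left (hmax v) (hpos _ _))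
  have edges : 2 * m = 2 * U.card + ∑ u ∈ U, ∑ v ∈ U, A u v + 2 * ∑ w ∈ W, ∑ v ∈ U, A w v
      + ∑ w ∈ W, ∑ v ∈ W, A w v := by
    have row_U : ∀ u ∈ U, ∑ w, A u w = 1 + ∑ v ∈ U, A u v + ∑ v ∈ W, A u v := fun u hu => by
      rw [hsplit, hUr u hu]
    have row_W : ∀ u ∈ W, ∑ w, A u w = ∑ v ∈ U, A u v + ∑ v ∈ W, A u v := fun u hu => by
      rw [hsplit, hWr u hu, zero_add]
    have swap : ∑ u ∈ U, ∑ w ∈ W, A u w = ∑ w ∈ W, ∑ u ∈ U, A w u := by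
      rw [Finset.sum_comm]
      exact Finset.sum_congr rfl fun w _ => Finset.sum_congr rfl fun u _ => hsymm u w
    rw [← hm, hsplit fun v => ∑ w, A v w, hsplit (A r), hrr, Finset.sum_congr rfl hrU,
      Finset.sum_congr rfl hrW, Finset.sum_congr rfl row_U, Finset.sum_congr rfl row_W]
    simp only [Finset.sum_add_distrib, Finset.sum_const, nsmul_eq_mul, swap]
    ring
  have hPU : P ⊆ U := fun p hp => by simp [hU, (hP p hp).1]
  have hcard : (P.card : ℝ) ≤ U.card := by exact_mod_cast Finset.card_le_card hPU
  have inner : ∑ u ∈ U, ((∑ v ∈ U, A u v) - 1) * x u ≤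
      (∑ u ∈ U, ∑ v ∈ U, A u v - P.card) * x r := by
    have hPc : (P.card : ℝ) = ∑ u ∈ U, if u ∈ P then (1 : ℝ) else 0 := by
      rw [Finset.sum_ite_mem, Finset.inter_eq_right.2 hPU]; simp
    rw [hPc, ← Finset.sum_sub_distrib, Finset.sum_mul]
    refine Finset.sum_le_sum fun u hu => ?_
    split_ifs with hu'
    · obtain ⟨-, q, hq, huq⟩ := hP u hu'
      have h1 : A u q ≤ ∑ v ∈ U, A u v :=
        Finset.single_le_sum (f := fun v => A u v) (fun v _ => hpos u v)
          (by simp [hU, hq] : q ∈ U)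
      rw [hA, if_pos huq] at h1
      exact mul_le_mul_of_nonneg_left (hmax u) (by linarith)
    · have h1 : 0 ≤ ∑ v ∈ U, A u v := Finset.sum_nonneg fun v _ => hpos u v
      have := mul_le_mul_of_nonneg_left (hmax u) h1
      have := hx u
      linarith
  have cross : ∑ w ∈ W, (∑ v ∈ U, A w v) * x w ≤ (∑ w ∈ W, ∑ v ∈ U, A w v) * x r := by
    rw [Finset.sum_mul]
    exact Finset.sum_le_sum fun w _ => mul_le_mul_of_nonneg_left (hmax w)
      (Finset.sum_nonneg fun v _ => hpos w v)
  simp only [sub_mul, one_mul, Finset.sum_sub_distrib] at inner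
  rw [← eig_r] at inner
  rw [← Finset.mul_sum, ← eig_r] at eig_U
  rw [← Finset.mul_sum] at eig_W
  have key : (m - 1) * x r ≤ (U.card + ∑ u ∈ U, ∑ v ∈ U, A u v - P.card
      + ∑ w ∈ W, ∑ v ∈ U, A w v) * x r := by
    have := mul_le_mul_of_nonneg_right hlow hr.le
    linarith
  have key' := le_of_mul_le_mul_right key hr
  refine eig_W.trans (mul_le_mul_of_nonneg_right ?_ hr.le)
  linarith

theorem SimpleGraph.Connected.exists_adj_boundary {T : Type*} {H : SimpleGraph T}
    (hH : H.Connected) {S : Set T} {u v : T} (hu : u ∈ S) (hv : v ∉ S) :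
    ∃ s ∈ S, ∃ t ∉ S, H.Adj s t := by
  obtain ⟨p⟩ := hH.preconnected u v
  obtain ⟨d, -, h1, h2⟩ := p.exists_boundary_dart S hu hv
  exact ⟨d.fst, h1, d.snd, h2, d.adj⟩

/-- The graph has no subgraph isomorphic to the path on five vertices. -/
def P5Free {T : Type*} (H : SimpleGraph T) : Prop :=
  ∀ a b c d e, [a, b, c, d, e].Nodup → H.Adj a b → H.Adj b c → H.Adj c d → H.Adj d e → False

theorem P5Free.no_fourCycle {T : Type*} [Fintype T] {H : SimpleGraph T} (hP : P5Free H)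
    (hH : H.Connected) (hcard : 5 ≤ Fintype.card T) {a b c d : T} (hnd : [a, b, c, d].Nodup)
    (hab : H.Adj a b) (hbc : H.Adj b c) (hcd : H.Adj c d) (hda : H.Adj d a) : False := by
  obtain ⟨v, hv⟩ : ∃ v, v ∉ ({a, b, c, d} : Finset T) := by
    by_contra! h
    have h1 : (univ : Finset T) ⊆ {a, b, c, d} := fun v _ => h v
    have h2 := (Finset.card_le_card h1).trans Finset.card_le_four
    rw [Finset.card_univ] at h2
    omega
  obtain ⟨s, hs, t, ht, hst⟩ := hH.exists_adj_boundary (S := {a, b, c, d}) (u := a) (v := v)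
    (by simp) (by simpa using hv)
  simp only [Set.mem_insert_iff, Set.mem_singleton_iff, not_or] at hs ht
  simp only [List.nodup_cons, List.mem_cons, List.not_mem_nil, not_or, or_false] at hnd
  rcases hs with rfl | rfl | rfl | rfl
  · exact hP t s b c d (by simp; tauto) hst.symm hab hbc hcd
  · exact hP t s c d a (by simp; tauto) hst.symm hbc hcd hda
  · exact hP t s d a b (by simp; tauto) hst.symm hcd hda hab
  · exact hP t s a b c (by simp; tauto) hst.symm hda hab hbc

theorem P5Free.adj_of_triangle {T : Type*} [Fintype T] {H : SimpleGraph T} (hP : P5Free H)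
    (hH : H.Connected) (hcard : 5 ≤ Fintype.card T) {a b c p : T}
    (hab : H.Adj a b) (hbc : H.Adj b c) (hca : H.Adj c a) (hpa : H.Adj a p) (hpb : p ≠ b)
    (hpc : p ≠ c) {u v : T} (huv : H.Adj u v) (hua : u ≠ a) (hub : u ≠ b) (huc : u ≠ c) :
    v = a := by
  have n1 := hab.ne
  have n2 := hbc.ne
  have n3 := hca.ne
  have n4 := hpa.ne
  have side : ∀ q, q ≠ a → q ≠ b → q ≠ c → ¬ H.Adj b q ∧ ¬ H.Adj c q := by
    intro q qa qb qc
    by_cases hqp : q = p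
    · subst hqp
      exact ⟨fun h => hP.no_fourCycle hH hcard (a := q) (b := a) (c := c) (d := b)
          (by simp; tauto) hpa.symm hca.symm hbc.symm h,
        fun h => hP.no_fourCycle hH hcard (a := q) (b := a) (c := b) (d := c)
          (by simp; tauto) hpa.symm hab hbc h⟩
    · exact ⟨fun h => hP p a c b q (by simp; tauto) hpa.symm hca.symm hbc.symm h,
        fun h => hP p a b c q (by simp; tauto) hpa.symm hab hbc h⟩
  have tail : ∀ q t, q ≠ b → q ≠ c → t ≠ a → t ≠ b → t ≠ c → H.Adj a q → ¬ H.Adj q t := by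
    intro q t qb qc ta tb tc haq hqt
    have n5 := hqt.ne
    have n6 := haq.ne
    exact hP t q a b c (by simp; tauto) hqt.symm haq.symm hab hbc
  have near : ∀ w, w ≠ a → w ≠ b → w ≠ c → H.Adj a w := by
    intro w wa wb wc
    by_contra haw
    obtain ⟨s, hs, t, ht, hst⟩ := hH.exists_adj_boundary
      (S := {y | y = a ∨ y = b ∨ y = c ∨ H.Adj a y}) (u := a) (v := w)
      (by simp) (by simp; tauto)
    simp only [Set.mem_ofPred_eq, not_or] at hs ht
    obtain ⟨ta, tb, tc, hat⟩ := ht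
    by_cases sb : s = b
    · subst sb; exact (side t ta tb tc).1 hst
    by_cases sc : s = c
    · subst sc; exact (side t ta tb tc).2 hst
    rcases hs with rfl | h | h | h
    · exact hat hst
    · exact sb h
    · exact sc h
    · exact tail s t sb sc ta tb tc h hst
  by_contra hva
  by_cases vb : v = b
  · subst vb; exact (side u hua hub huc).1 huv.symm
  by_cases vc : v = c
  · subst vc; exact (side u hua hub huc).2 huv.symm
  exact tail u v hub huc hva vb vc (near u hua hub huc) huv

theorem P5Free.card_edgeFinset_le_of_triangle {T : Type*} [Fintype T] {H : SimpleGraph T}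
    (hP : P5Free H) (hH : H.Connected) (hcard : 5 ≤ Fintype.card T) {a b c p : T}
    (hab : H.Adj a b) (hbc : H.Adj b c) (hca : H.Adj c a) (hpa : H.Adj a p) (hpb : p ≠ b)
    (hpc : p ≠ c) : #H.edgeFinset ≤ Fintype.card T := by
  have far : ∀ u v, H.Adj u v → u ≠ a → u ≠ b → u ≠ c → v = a :=
    fun u v huv => hP.adj_of_triangle hH hcard hab hbc hca hpa hpb hpc huv
  have hsub : H.edgeFinset ⊆
      univ.image fun v => s(v, if v = a then b else if v = b then c else a) := by
    intro e
    induction e with | _ u v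
    intro huv
    rw [SimpleGraph.mem_edgeFinset, SimpleGraph.mem_edgeSet] at huv
    rw [Finset.mem_image]
    have n0 := huv.ne
    have n1 := hab.ne
    have n2 := hbc.ne
    have n3 := hca.ne
    by_cases hu : u ≠ a ∧ u ≠ b ∧ u ≠ c
    · have := far u v huv hu.1 hu.2.1 hu.2.2
      exact ⟨u, by simp [hu.1, hu.2.1, this]⟩
    by_cases hv : v ≠ a ∧ v ≠ b ∧ v ≠ c
    · have := far v u huv.symm hv.1 hv.2.1 hv.2.2
      exact ⟨v, by simp [hv.1, hv.2.1, this]⟩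
    have hu' : u = a ∨ u = b ∨ u = c := by tauto
    have hv' : v = a ∨ v = b ∨ v = c := by tauto
    have e2 : (if c = a then b else if c = b then c else a) = a := by simp [n3, n2.symm]
    rcases hu' with rfl | rfl | rfl <;> rcases hv' with rfl | rfl | rfl
    · exact absurd rfl n0
    · exact ⟨u, by simp⟩
    · exact ⟨v, by simp [e2]⟩
    · exact ⟨v, by simp⟩
    · exact absurd rfl n0
    · exact ⟨u, by simp [n1.symm]⟩
    · exact ⟨u, by simp [e2]⟩
    · exact ⟨v, by simp [n1.symm]⟩
    · exact absurd rfl n0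
  exact (Finset.card_le_card hsub).trans (Finset.card_image_le.trans (by simp))

theorem P5Free.card_edgeFinset_le {T : Type*} [Fintype T] {H : SimpleGraph T}
    (hP : P5Free H) (hH : H.Connected) (hcard : 5 ≤ Fintype.card T) :
    #H.edgeFinset ≤ Fintype.card T := by
  by_cases hac : H.IsAcyclic
  · have := (SimpleGraph.IsTree.mk hH hac).card_edgeFinset
    omega
  simp only [SimpleGraph.IsAcyclic, not_forall, not_not] at hac
  obtain ⟨r, p, hp⟩ := hac
  have h3 := hp.three_le_length
  have hne : ∀ i j, i < j → j < p.length → p.getVert i ≠ p.getVert j := by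
    intro i j hij hj h
    have := hp.getVert_injOn' (show i ≤ p.length - 1 by omega) (show j ≤ p.length - 1 by omega) h
    omega
  have hadj : ∀ i, i < p.length → H.Adj (p.getVert i) (p.getVert (i + 1)) :=
    fun i hi => p.adj_getVert_succ hi
  have hlast : p.getVert p.length = p.getVert 0 := by simp
  obtain h5 | h4 | h3 : 5 ≤ p.length ∨ p.length = 4 ∨ p.length = 3 := by omega
  · refine (hP (p.getVert 0) (p.getVert 1) (p.getVert 2) (p.getVert 3) (p.getVert 4) ?_
      (hadj _ (by omega)) (hadj _ (by omega)) (hadj _ (by omega)) (hadj _ (by omega))).elim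
    simp only [List.nodup_cons, List.mem_cons, List.not_mem_nil, not_or, or_false,
      not_false_eq_true, List.nodup_nil, and_true]
    refine ⟨⟨?_, ?_, ?_, ?_⟩, ⟨?_, ?_, ?_⟩, ⟨?_, ?_⟩, ?_⟩ <;>
      exact hne _ _ (by omega) (by omega)
  · have h30 := hadj 3 (by omega)
    rw [show 3 + 1 = p.length from h4.symm, hlast] at h30
    refine (hP.no_fourCycle hH hcard ?_ (hadj 0 (by omega)) (hadj 1 (by omega))
      (hadj 2 (by omega)) h30).elim
    simp only [List.nodup_cons, List.mem_cons, List.not_mem_nil, not_or, or_false,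
      not_false_eq_true, List.nodup_nil, and_true]
    refine ⟨⟨?_, ?_, ?_⟩, ⟨?_, ?_⟩, ?_⟩ <;> exact hne _ _ (by omega) (by omega)
  · have hab := hadj 0 (by omega)
    have hbc := hadj 1 (by omega)
    have hca := hadj 2 (by omega)
    rw [show 2 + 1 = p.length from h3.symm, hlast] at hca
    simp only [Nat.reduceAdd, zero_add] at hab hbc hca
    generalize p.getVert 0 = a at *
    generalize p.getVert 1 = b at *
    generalize p.getVert 2 = c at *
    obtain ⟨v, hv⟩ : ∃ v, v ∉ ({a, b, c} : Finset T) := by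
      by_contra! h
      have h1 : (univ : Finset T) ⊆ {a, b, c} := fun v _ => h v
      have h2 := (Finset.card_le_card h1).trans Finset.card_le_three
      rw [Finset.card_univ] at h2
      omega
    obtain ⟨s, hs, t, ht, hst⟩ := hH.exists_adj_boundary (S := {a, b, c}) (u := a) (v := v)
      (by simp) (by simpa using hv)
    simp only [Set.mem_insert_iff, Set.mem_singleton_iff, not_or] at hs ht
    obtain ⟨ta, tb, tc⟩ := ht
    rcases hs with rfl | rfl | rfl
    · exact hP.card_edgeFinset_le_of_triangle hH hcard hab hbc hca hst tb tc
    · exact hP.card_edgeFinset_le_of_triangle hH hcard hbc hca hab hst tc ta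
    · exact hP.card_edgeFinset_le_of_triangle hH hcard hca hab hbc hst ta tb

theorem SimpleGraph.exists_diamond_of_card_four {T : Type*} [Fintype T] (H : SimpleGraph T)
    (hcard : Fintype.card T = 4) (hE : 5 ≤ #H.edgeFinset) :
    ∃ a b c d : T, [a, b, c, d].Nodup ∧ (univ : Finset T) = {a, b, c, d} ∧
      H.Adj c d ∧ H.Adj c a ∧ H.Adj c b ∧ H.Adj d a ∧ H.Adj d b := by
  obtain ⟨p, q, r, s, hpq, hpr, hps, hqr, hqs, hrs, huniv⟩ :=
    Finset.card_eq_four.1 (Finset.card_univ.trans hcard)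
  have hsum := H.sum_degrees_eq_twice_card_edges
  have hdeg : ∀ t, H.degree t = ∑ u, if H.Adj t u then 1 else 0 := fun t => by
    rw [Finset.sum_boole, ← H.card_neighborFinset_eq_degree, H.neighborFinset_eq_filter]; simp
  have hexp : ∀ F : T → ℕ, ∑ t, F t = F p + F q + F r + F s := fun F => by
    rw [huniv, Finset.sum_insert (by simp; tauto), Finset.sum_insert (by simp; tauto),
      Finset.sum_insert (by simp; tauto), Finset.sum_singleton]
    ring
  simp only [hdeg, hexp, SimpleGraph.irrefl, if_false, H.adj_comm q p, H.adj_comm r p,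
    H.adj_comm s p, H.adj_comm r q, H.adj_comm s q, H.adj_comm s r] at hsum
  have relabel : ∀ a b c d : T, [a, b, c, d].Nodup →
      (∀ t, (t = p ∨ t = q ∨ t = r ∨ t = s) ↔ (t = a ∨ t = b ∨ t = c ∨ t = d)) →
      H.Adj c d → H.Adj c a → H.Adj c b → H.Adj d a → H.Adj d b →
      ∃ a b c d : T, [a, b, c, d].Nodup ∧ (univ : Finset T) = {a, b, c, d} ∧
        H.Adj c d ∧ H.Adj c a ∧ H.Adj c b ∧ H.Adj d a ∧ H.Adj d b :=
    fun a b c d h0 h h1 h2 h3 h4 h5 => 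
      ⟨a, b, c, d, h0, huniv.trans (by ext t; simpa using h t), h1, h2, h3, h4, h5⟩
  by_cases h1 : H.Adj p q <;> by_cases h2 : H.Adj p r <;> by_cases h3 : H.Adj p s <;>
    by_cases h4 : H.Adj q r <;> by_cases h5 : H.Adj q s <;> by_cases h6 : H.Adj r s <;>
    simp only [h1, h2, h3, h4, h5, h6, if_true, if_false] at hsum <;>
    first
    | (exfalso; omega)
    | exact relabel p q r s (by simp; tauto) (fun t => by tauto)
        h6 h2.symm h4.symm h3.symm h5.symm
    | exact relabel p r q s (by simp; tauto) (fun t => by tauto)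
        h5 h1.symm h4 h3.symm h6.symm
    | exact relabel p s q r (by simp; tauto) (fun t => by tauto)
        h4 h1.symm h5 h2.symm h6
    | exact relabel q r p s (by simp; tauto) (fun t => by tauto)
        h3 h1 h2 h5.symm h6.symm
    | exact relabel q s p r (by simp; tauto) (fun t => by tauto)
        h2 h1 h3 h4.symm h6
    | exact relabel r s p q (by simp; tauto) (fun t => by tauto)
        h1 h2 h3 h4 h5

theorem F6Free.no_common_neighbor {V : Type*} {G : SimpleGraph V} (hfree : F6Free G)
    {r a b c d w : V} (hnd : [a, b, c, d].Nodup) (hra : G.Adj r a) (hrb : G.Adj r b)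
    (hrc : G.Adj r c) (hrd : G.Adj r d) (hcd : G.Adj c d) (hca : G.Adj c a) (hcb : G.Adj c b)
    (hda : G.Adj d a) (hdb : G.Adj d b) (hwr : w ≠ r) (hw : ¬ G.Adj r w) (hcw : G.Adj c w) :
    ¬ G.Adj d w ∧ ¬ G.Adj a w ∧ ¬ G.Adj b w := by
  have wa : w ≠ a := by rintro rfl; exact hw hra
  have wb : w ≠ b := by rintro rfl; exact hw hrb
  have wd : w ≠ d := by rintro rfl; exact hw hrd
  have ra := hra.ne
  have rb := hrb.ne
  have rd := hrd.ne
  simp only [List.nodup_cons, List.mem_cons, List.not_mem_nil, not_or, or_false] at hnd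
  refine ⟨fun h => ?_, fun h => ?_, fun h => ?_⟩
  · exact hfree.no_fan (h := c) (a := w) (b := d) (c := a) (d := r) (e := b)
      (by simp; tauto) hcw hcd hca hrc.symm hcb h.symm hda hra.symm hrb
  · exact hfree.no_fan (h := c) (a := w) (b := a) (c := d) (d := b) (e := r)
      (by simp; tauto) hcw hca hcd hcb hrc.symm h.symm hda.symm hdb hrb.symm
  · exact hfree.no_fan (h := c) (a := w) (b := b) (c := d) (d := a) (e := r)
      (by simp; tauto) hcw hcb hcd hca hrc.symm h.symm hdb.symm hda hra.symm

theorem diamond_component_weight {V : Type*} [Fintype V] {G : SimpleGraph V} (hfree : F6Free G)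
    (A : V → V → ℝ)
    (hA : ∀ v w, A v w = if G.Adj v w then 1 else 0) (m : ℝ)
    (hm : ∑ v, ∑ w, A v w = 2 * m) (lam : ℝ) (hlow : m ≤ lam ^ 2 - lam + 1) (hlam : 9 ≤ lam)
    (x : V → ℝ) (hx : ∀ v, 0 ≤ x v) (heig : ∀ v, ∑ w, A v w * x w = lam * x v)
    (r : V) (hr : 0 < x r) (hmax : ∀ v, x v ≤ x r) {a b c d : V} (hnd : [a, b, c, d].Nodup)
    (hra : G.Adj r a) (hrb : G.Adj r b) (hrc : G.Adj r c) (hrd : G.Adj r d)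
    (hcd : G.Adj c d) (hca : G.Adj c a) (hcb : G.Adj c b) (hda : G.Adj d a) (hdb : G.Adj d b)
    (hclosed : ∀ v ∈ ({a, b, c, d} : Finset V), ∀ u, G.Adj r u → G.Adj v u →
      u ∈ ({a, b, c, d} : Finset V)) :
    2 * x c + 2 * x d + (1 + A a b) * (x a + x b) ≤ (5 + A a b) * x r := by
  have hnd' := hnd
  simp only [List.nodup_cons, List.mem_cons, List.not_mem_nil, not_or, or_false] at hnd'
  obtain ⟨⟨nab, nac, nad⟩, ⟨nbc, nbd⟩, ncd, -⟩ := hnd'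
  have exp4 : ∀ F : V → ℝ, ∑ u ∈ ({a, b, c, d} : Finset V), F u = F a + F b + F c + F d := by
    intro F
    rw [Finset.sum_insert (by simp; tauto), Finset.sum_insert (by simp; tauto),
      Finset.sum_insert (by simp; tauto), Finset.sum_singleton]
    ring
  have hcardP : #({a, b, c, d} : Finset V) = 4 :=
    Finset.card_eq_four.2 ⟨a, b, c, d, nab, nac, nad, nbc, nbd, ncd, rfl⟩
  have hSW := far_vertices_weight_bound G A hA m hm lam hlow x hx heig r hr hmax {a, b, c, d}
    (by
      intro p hp
      simp only [Finset.mem_insert, Finset.mem_singleton] at hp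
      rcases hp with rfl | rfl | rfl | rfl
      · exact ⟨hra, c, hrc, hca.symm⟩
      · exact ⟨hrb, c, hrc, hcb.symm⟩
      · exact ⟨hrc, d, hrd, hcd⟩
      · exact ⟨hrd, c, hrc, hcd.symm⟩)
  rw [hcardP] at hSW
  set W := univ.filter fun v => v ≠ r ∧ ¬ G.Adj r v with hW
  have hsymm : ∀ v w, A v w = A w v := fun v w => by simp only [hA, G.adj_comm]
  have expand : ∀ v ∈ ({a, b, c, d} : Finset V), G.Adj r v → lam * x v =
      x r + (A v a * x a + A v b * x b + A v c * x c + A v d * x d) + ∑ w ∈ W, A v w * x w := by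
    intro v hv hrv
    rw [← heig, sum_split_neighbors (G := G) r, hA v r, if_pos hrv.symm, one_mul,
      ← exp4 fun u => A v u * x u]
    congr 2
    symm
    apply Finset.sum_subset
    · intro u hu
      simp only [Finset.mem_insert, Finset.mem_singleton] at hu
      rcases hu with rfl | rfl | rfl | rfl <;> simpa
    · intro u hu hu'
      have : ¬ G.Adj v u := fun h => hu' (hclosed v hv u (Finset.mem_filter.1 hu).2 h)
      rw [hA, if_neg this, zero_mul]
  have self : ∀ v, A v v = 0 := fun v => by simp [hA]
  have one : ∀ v w, G.Adj v w → A v w = 1 := fun v w h => by rw [hA, if_pos h]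
  have ea := expand a (by simp) hra
  have eb := expand b (by simp) hrb
  have ec := expand c (by simp) hrc
  have ed := expand d (by simp) hrd
  rw [self, one a c hca.symm, one a d hda.symm] at ea
  rw [self, one b c hcb.symm, one b d hdb.symm, hsymm b a] at eb
  rw [self, one c a hca, one c b hcb, one c d hcd] at ec
  rw [self, one d a hda, one d b hdb, one d c hcd.symm] at ed
  have hfar : 2 * ∑ w ∈ W, A c w * x w + 2 * ∑ w ∈ W, A d w * x w
      + (1 + A a b) * (∑ w ∈ W, A a w * x w + ∑ w ∈ W, A b w * x w) ≤ 2 * ∑ w ∈ W, x w := by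
    simp only [Finset.mul_sum, ← Finset.sum_add_distrib]
    refine Finset.sum_le_sum fun w hw => ?_
    obtain ⟨hwr, hrw⟩ := (Finset.mem_filter.1 hw).2
    have coef : 2 * A c w + 2 * A d w + (1 + A a b) * (A a w + A b w) ≤ 2 := by
      have hc := hfree.no_common_neighbor hnd hra hrb hrc hrd hcd hca hcb hda hdb hwr hrw
      have hd := hfree.no_common_neighbor (a := a) (b := b) (c := d) (d := c) (by simp; tauto)
        hra hrb hrd hrc hcd.symm hda hdb hca hcb hwr hrw
      have hab := fun h : G.Adj a b =>
        hfree.no_common_neighbor (a := c) (b := d) (c := a) (d := b) (by simp; tauto)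
          hrc hrd hra hrb h hca.symm hda.symm hcb.symm hdb.symm hwr hrw
      simp only [hA]
      by_cases h1 : G.Adj c w
      · simp [h1, hc h1]
      by_cases h2 : G.Adj d w
      · simp [h2, hd h2]
      by_cases h3 : G.Adj a b <;> by_cases h4 : G.Adj a w
      · simp only [h1, h2, h3, h4, hab h3 h4, if_true, if_false]
        norm_num
      all_goals
        simp only [h1, h2, h3, h4, if_true, if_false]
        split_ifs <;> norm_num
    have := mul_le_mul_of_nonneg_right coef (hx w)
    linarith
  have ha' := hmax a
  have hb' := hmax b
  have hc' := hmax c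
  have hd' := hmax d
  have hSW' : lam * ∑ w ∈ W, x w ≤ (lam ^ 2 - lam - 6) * x r := by
    have := mul_le_mul_of_nonneg_right hlow hr.le
    push_cast at hSW
    linarith
  generalize ∑ w ∈ W, x w = S at *
  have hlamX : 0 ≤ lam * x r := by positivity
  by_contra! hbad
  by_cases hab : G.Adj a b
  · rw [one a b hab] at *
    have h1 : lam * (6 * x r) < 32 * x r + 2 * S := by
      have := mul_lt_mul_of_pos_left hbad (by linarith : 0 < lam)
      linarith
    have h2 := mul_lt_mul_of_pos_left h1 (by linarith : 0 < lam)
    have h3 : 0 < (4 * lam ^ 2 - 30 * lam + 12) * x r := mul_pos (by nlinarith) hr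
    linarith
  · rw [hA a b, if_neg hab] at *
    have h1 : lam * (5 * x r) < 22 * x r + 2 * S := by
      have := mul_lt_mul_of_pos_left hbad (by linarith : 0 < lam)
      linarith
    have h2 := mul_lt_mul_of_pos_left h1 (by linarith : 0 < lam)
    have h3 : 0 < (3 * lam ^ 2 - 20 * lam + 12) * x r := mul_pos (by nlinarith) hr
    linarith

theorem gamma_image_eq {V T : Type*} [Fintype V] [Fintype T] (G : SimpleGraph V)
    (H : SimpleGraph T) (f : T → V) (hf : Function.Injective f)
    (hadj : ∀ s t, H.Adj s t ↔ G.Adj (f s) (f t)) (x : V → ℝ) (r : V) :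
    gamma G x r (Set.range f) =
      ∑ t, ((H.degree t : ℝ) - 1) * (x (f t) / x r) - #H.edgeFinset := by
  have hdeg : ∀ t, dS G (Set.range f) (f t) = H.degree t := by
    intro t
    have : G.neighborSet (f t) ∩ Set.range f = f '' H.neighborSet t := by
      ext v
      constructor
      · rintro ⟨hv, s, rfl⟩
        exact ⟨s, (hadj t s).2 hv, rfl⟩
      · rintro ⟨s, hs, rfl⟩
        exact ⟨(hadj t s).1 hs, s, rfl⟩
    rw [dS, this, Set.ncard_image_of_injective _ hf, ← H.card_neighborSet_eq_degree,
      Set.ncard_eq_toFinset_card', Set.toFinset_card]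
  have hedge : eIn G (Set.range f) = #H.edgeFinset := by
    have : {e ∈ G.edgeSet | ∀ v ∈ e, v ∈ Set.range f} = Sym2.map f '' H.edgeSet := by
      ext e
      constructor
      · induction e with | _ u v
        rintro ⟨he, hmem⟩
        obtain ⟨s, rfl⟩ := hmem u (by simp)
        obtain ⟨t, rfl⟩ := hmem v (by simp)
        exact ⟨s(s, t), (hadj s t).2 he, rfl⟩
      · rintro ⟨e, he, rfl⟩
        induction e with | _ s t
        refine ⟨(hadj s t).1 he, ?_⟩
        intro v hv
        simp only [Sym2.map_mk, Sym2.mem_iff] at hv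
        rcases hv with rfl | rfl
        exacts [⟨s, rfl⟩, ⟨t, rfl⟩]
    rw [eIn, this, Set.ncard_image_of_injective _ (Sym2.map.injective hf),
      Set.ncard_eq_toFinset_card', SimpleGraph.edgeFinset]
  have himage : ∀ inst : Fintype (Set.range f),
      @Set.toFinset V (Set.range f) inst = univ.image f := fun _ => by
    ext v
    simp
  rw [gamma, hedge, himage, Finset.sum_image fun s _ t _ h => hf h]
  simp only [hdeg]

theorem sum_degree_weight_sub_card_edges_le {T : Type*} [Fintype T] (H : SimpleGraph T)
    (hdeg : ∀ t, 1 ≤ H.degree t) (y : T → ℝ) (hy : ∀ t, y t ≤ 1) :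
    ∑ t, ((H.degree t : ℝ) - 1) * y t - #H.edgeFinset ≤ #H.edgeFinset - Fintype.card T := by
  have h1 : ∑ t, ((H.degree t : ℝ) - 1) * y t ≤ ∑ t, ((H.degree t : ℝ) - 1) := by
    refine Finset.sum_le_sum fun t _ => mul_le_of_le_one_right ?_ (hy t)
    have : (1 : ℝ) ≤ H.degree t := by exact_mod_cast hdeg t
    linarith
  have h2 : (∑ t, (H.degree t : ℝ)) = 2 * #H.edgeFinset := by
    exact_mod_cast H.sum_degrees_eq_twice_card_edges
  rw [Finset.sum_sub_distrib, h2, Finset.sum_const, Finset.card_univ, nsmul_eq_mul, mul_one] at h1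
  linarith

theorem sum_degree_weight_diamond {T : Type*} [Fintype T] (H : SimpleGraph T) {a b c d : T}
    (hnd : [a, b, c, d].Nodup) (huniv : (univ : Finset T) = {a, b, c, d})
    (hcd : H.Adj c d) (hca : H.Adj c a) (hcb : H.Adj c b) (hda : H.Adj d a) (hdb : H.Adj d b)
    (y : T → ℝ) :
    ∑ t, ((H.degree t : ℝ) - 1) * y t - #H.edgeFinset =
      2 * y c + 2 * y d + (1 + if H.Adj a b then 1 else 0) * (y a + y b)
        - (5 + if H.Adj a b then 1 else 0) := by
  simp only [List.nodup_cons, List.mem_cons, List.not_mem_nil, not_or, or_false] at hnd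
  have hexp : ∀ F : T → ℝ, ∑ t, F t = F a + F b + F c + F d := fun F => by
    rw [huniv, Finset.sum_insert (by simp; tauto), Finset.sum_insert (by simp; tauto),
      Finset.sum_insert (by simp; tauto), Finset.sum_singleton]
    ring
  have hdeg : ∀ t, (H.degree t : ℝ) = ∑ u, if H.Adj t u then 1 else 0 := fun t => by
    rw [Finset.sum_boole, ← H.card_neighborFinset_eq_degree, H.neighborFinset_eq_filter]
  have hsum : (∑ t, (H.degree t : ℝ)) = 2 * #H.edgeFinset := by
    exact_mod_cast H.sum_degrees_eq_twice_card_edges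
  have hE : (#H.edgeFinset : ℝ) = (∑ t, (H.degree t : ℝ)) / 2 := by linarith
  rw [hE]
  simp only [hdeg, hexp, SimpleGraph.irrefl, if_false, H.adj_comm b a, hcd, hcd.symm, hca,
    hca.symm, hcb, hcb.symm, hda, hda.symm, hdb, hdb.symm, if_true]
  ring

theorem stmt_9 
    {V : Type} [Fintype V] [DecidableEq V] (G : SimpleGraph V) [DecidableRel G.Adj]
    (m : ℕ) (hm : 88 ≤ m)
    (hfree : F6Free G)
    (hcard : G.edgeSet.ncard = m)
    (hnoiso : ∀ v : V, ∃ w, G.Adj v w)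
    (hmax : ∀ (n : ℕ) (G' : SimpleGraph (Fin n)), F6Free G' → G'.edgeSet.ncard = m →
      (∀ v, ∃ w, G'.Adj v w) → specRad G' ≤ specRad G)
    (lam : ℝ) (hlam : lam = specRad G)
    (hconn : G.Connected)
    (hlow : (1 + Real.sqrt (4 * (m : ℝ) - 3)) / 2 ≤ lam)
    (x : V → ℝ) (hxpos : ∀ v, 0 < x v)
    (heig : (G.adjMatrix ℝ).mulVec x = lam • x)
    (ustar : V) (hustar : ∀ v, x v ≤ x ustar)
   
    (C : (G.induce (G.neighborSet ustar)).ConnectedComponent)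
    (hnt : ∃ a b, a ∈ C.supp ∧ b ∈ C.supp ∧ (G.induce (G.neighborSet ustar)).Adj a b) :
    gamma G x ustar (Subtype.val '' C.supp) ≤ 0 := by
  set H := C.toSimpleGraph with hH
  have hconnH : H.Connected := C.connected_toSimpleGraph
  let f : C → V := fun t => t.val.val
  have hf : Function.Injective f := Subtype.val_injective.comp Subtype.val_injective
  have hadj : ∀ s t, H.Adj s t ↔ G.Adj (f s) (f t) := fun s t => Iff.rfl
  have hhub : ∀ t, G.Adj ustar (f t) := fun t => t.val.property
  have hrange : Subtype.val '' C.supp = Set.range f := by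
    ext v
    constructor
    · rintro ⟨u, hu, rfl⟩
      exact ⟨⟨u, hu⟩, rfl⟩
    · rintro ⟨t, rfl⟩
      exact ⟨t.val, t.property, rfl⟩
  have hclosed : ∀ t u, G.Adj ustar u → G.Adj (f t) u → ∃ s, f s = u := by
    intro t u hu htu
    have hmem : (⟨u, hu⟩ : G.neighborSet ustar) ∈ C.supp :=
      C.mem_supp_of_adj_mem_supp t.property
        (show (G.induce (G.neighborSet ustar)).Adj t.val ⟨u, hu⟩ from htu)
    exact ⟨⟨_, hmem⟩, rfl⟩
  have hP : P5Free H := fun a b c d e hnd hab hbc hcd hde =>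
    hfree.no_fan (h := ustar) (hnd.map hf) (hhub a) (hhub b) (hhub c) (hhub d) (hhub e)
      hab hbc hcd hde
  have hdegH : ∀ t, 1 ≤ H.degree t := by
    obtain ⟨a, b, ha, hb, hab⟩ := hnt
    have : Nontrivial C := ⟨⟨a, ha⟩, ⟨b, hb⟩, fun h => hab.ne (congrArg Subtype.val h)⟩
    exact fun t => hconnH.preconnected.degree_pos_of_nontrivial t
  have hx0 := hxpos ustar
  rw [hrange, gamma_image_eq G H f hf hadj]
  have hbound := sum_degree_weight_sub_card_edges_le H hdegH (fun t => x (f t) / x ustar)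
    fun t => (div_le_one hx0).2 (hustar _)
  by_cases hE : #H.edgeFinset ≤ Fintype.card C
  · have : (#H.edgeFinset : ℝ) ≤ Fintype.card C := by exact_mod_cast hE
    linarith
  have hcard4 : Fintype.card C ≤ 4 := by
    by_contra! h
    exact hE (hP.card_edgeFinset_le hconnH h)
  have hchoose := H.card_edgeFinset_le_card_choose_two
  have hcardC : Fintype.card C = 4 := by
    by_contra h
    have h3 : Fintype.card C ≤ 3 := by omega
    have hsmall : ∀ n ≤ 3, n.choose 2 ≤ n := by decide
    exact hE (hchoose.trans (hsmall _ h3))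
  obtain ⟨a, b, c, d, hnd, huniv, hcd, hca, hcb, hda, hdb⟩ :=
    H.exists_diamond_of_card_four hcardC (by omega)
  rw [sum_degree_weight_diamond H hnd huniv hcd hca hcb hda hdb]
  have hm' : (88 : ℝ) ≤ m := by exact_mod_cast hm
  have hsq : Real.sqrt (4 * (m : ℝ) - 3) ^ 2 = 4 * m - 3 := Real.sq_sqrt (by linarith)
  have hsq0 := Real.sqrt_nonneg (4 * (m : ℝ) - 3)
  have hlam9 : 9 ≤ lam := by
    have : (17 : ℝ) ≤ Real.sqrt (4 * (m : ℝ) - 3) := Real.le_sqrt_of_sq_le (by linarith)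
    linarith
  have hm_le : (m : ℝ) ≤ lam ^ 2 - lam + 1 := by nlinarith
  have hA : ∀ v w, G.adjMatrix ℝ v w =
      @ite ℝ (G.Adj v w) (Classical.propDecidable _) 1 0 := fun v w => by
    by_cases h : G.Adj v w <;> simp [h]
  have hsum : ∑ v, ∑ w, G.adjMatrix ℝ v w = 2 * (m : ℝ) := by
    have h1 : (∑ v, (G.degree v : ℝ)) = 2 * #G.edgeFinset := by
      exact_mod_cast G.sum_degrees_eq_twice_card_edges
    have h2 : #G.edgeFinset = m := by
      rw [← hcard, Set.ncard_eq_toFinset_card', SimpleGraph.edgeFinset]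
    rw [← h2, ← h1]
    refine Finset.sum_congr rfl fun v _ => ?_
    simp [SimpleGraph.adjMatrix_apply, Finset.sum_boole, ← G.card_neighborFinset_eq_degree,
      G.neighborFinset_eq_filter]
  have hmain := diamond_component_weight hfree (fun v w => G.adjMatrix ℝ v w) hA m hsum lam
    hm_le hlam9 x (fun v => (hxpos v).le) (fun v => congrFun heig v) ustar hx0 hustar
    (a := f a) (b := f b) (c := f c) (d := f d) (hnd.map hf) (hhub a) (hhub b) (hhub c)
    (hhub d) hcd hca hcb hda hdb
    (by
      intro v hv u hu hvu
      have hv' : ∃ t, f t = v := by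
        simp only [Finset.mem_insert, Finset.mem_singleton] at hv
        rcases hv with rfl | rfl | rfl | rfl <;> exact ⟨_, rfl⟩
      obtain ⟨t, rfl⟩ := hv'
      obtain ⟨s, rfl⟩ := hclosed t u hu hvu
      have hs := Finset.mem_univ s
      rw [huniv] at hs
      simp only [Finset.mem_insert, Finset.mem_singleton] at hs ⊢
      rcases hs with rfl | rfl | rfl | rfl <;> simp)
  simp only [hA] at hmain
  have hab : H.Adj a b ↔ G.Adj (f a) (f b) := hadj a b
  simp only [hab]
  have hdiv : ∀ ε : ℝ, 2 * (x (f c) / x ustar) + 2 * (x (f d) / x ustar)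
      + (1 + ε) * (x (f a) / x ustar + x (f b) / x ustar)
      = (2 * x (f c) + 2 * x (f d) + (1 + ε) * (x (f a) + x (f b))) / x ustar := fun ε => by
    ring
  rw [hdiv, sub_nonpos, div_le_iff₀ hx0]
  by_cases h : G.Adj (f a) (f b)
  · simpa only [h, if_true] using hmain
  · simpa only [h, if_false] using hmain
end

section
/- Under the setup, the number of nontrivial components H of G*[U] satisfying γ(H) > 0 is strictly less than (2/5)λ + 7/10. -/
open SimpleGraph Finset
open scoped Classical

/-- A graph has no path on five vertices (as a subgraph). -/
def NoP5 {W : Type*} (K : SimpleGraph W) : Prop :=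
  ∀ p : Fin 5 → W, Function.Injective p → ¬ ∀ i : Fin 4, K.Adj (p i.castSucc) (p i.succ)

lemma NoP5.not_path {W : Type*} {K : SimpleGraph W} (hK : NoP5 K) {a b c d e : W}
    (hab : K.Adj a b) (hbc : K.Adj b c) (hcd : K.Adj c d) (hde : K.Adj d e)
    (hac : a ≠ c) (had : a ≠ d) (hae : a ≠ e) (hbd : b ≠ d) (hbe : b ≠ e) (hce : c ≠ e) :
    False := by
  refine hK ![a, b, c, d, e] ?_ ?_
  · have h1 := hab.ne
    have h2 := hbc.ne
    have h3 := hcd.ne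
    have h4 := hde.ne
    intro i j hij
    fin_cases i <;> fin_cases j <;> simp_all
  · intro i
    fin_cases i <;> simpa

lemma NoP5.comap {W X : Type*} {K : SimpleGraph W} {L : SimpleGraph X} (f : L ↪g K)
    (hK : NoP5 K) : NoP5 L := fun p hp h =>
  hK (f ∘ p) (f.injective.comp hp) fun i => f.map_adj_iff.2 (h i)

lemma F6Free.noP5_induce {V : Type*} {G : SimpleGraph V} (hG : F6Free G) (u : V) :
    NoP5 (G.induce (G.neighborSet u)) := by
  intro p hp h
  have hu (i : Fin 5) : G.Adj u (p i) := (p i).2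
  have h' (i : Fin 4) : G.Adj (p i.castSucc) (p i.succ) := h i
  refine hG ⟨⟨Fin.snoc (α := fun _ => V) (fun i => (p i : V)) u, ?_⟩, ?_⟩
  · have key : ∀ a b : Fin 6, (b = 5 ∨ (b.val = a.val + 1 ∧ b.val ≤ 4)) → a ≠ b →
        G.Adj (Fin.snoc (α := fun _ => V) (fun i => (p i : V)) u a)
          (Fin.snoc (α := fun _ => V) (fun i => (p i : V)) u b) := by
      intro a b hab hne
      induction a using Fin.lastCases with
      | last =>
        exfalso
        rcases hab with rfl | ⟨h1, h2⟩
        · exact hne rfl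
        · simp at h1; omega
      | cast a =>
        induction b using Fin.lastCases with
        | last =>
          rw [Fin.snoc_castSucc, Fin.snoc_last]
          exact (hu a).symm
        | cast b =>
          rcases hab with hb | ⟨hb, hb'⟩
          · have := congrArg Fin.val hb
            have h5 := b.isLt
            simp at this
            omega
          · simp only [Fin.snoc_castSucc]
            simp only [Fin.val_castSucc] at hb hb'
            have ha : a.val < 4 := by omega
            obtain rfl : b = (⟨a.val, ha⟩ : Fin 4).succ := Fin.ext hb
            exact h' ⟨a.val, ha⟩
    intro a b hab
    obtain ⟨hne, hab | hab⟩ := (SimpleGraph.fromRel_adj _ _ _).1 hab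
    · exact key a b hab hne
    · exact (key b a hab hne.symm).symm
  · refine Fin.snoc_injective_iff.2 ⟨Subtype.val_injective.comp hp, ?_⟩
    rintro ⟨i, hi⟩
    exact (hu i).ne hi.symm

lemma exists_adj_notMem {W : Type*} {K : SimpleGraph W} (hc : K.Connected) (S : Finset W)
    {a : W} (ha : a ∈ S) {b : W} (hb : b ∉ S) : ∃ u ∈ S, ∃ v ∉ S, K.Adj u v := by
  obtain ⟨p⟩ := hc.preconnected a b
  obtain ⟨d, -, h1, h2⟩ := p.exists_boundary_dart (S : Set W) ha hb
  exact ⟨_, h1, _, h2, d.adj⟩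

section Finite

variable {W : Type*} [Fintype W] {K : SimpleGraph W}

lemma exists_notMem_of_card_lt (S : Finset W) (h : S.card < Fintype.card W) : ∃ v, v ∉ S := by
  by_contra! hS
  rw [Finset.eq_univ_iff_forall.2 hS, Finset.card_univ] at h
  exact h.false

lemma NoP5.not_cycle_four (hK : NoP5 K) (hc : K.Connected) (hn : 5 ≤ Fintype.card W)
    {a b c d : W} (hab : K.Adj a b) (hbc : K.Adj b c) (hcd : K.Adj c d) (hda : K.Adj d a)
    (hac : a ≠ c) (hbd : b ≠ d) : False := by
  obtain ⟨w, hw⟩ := exists_notMem_of_card_lt ({a, b, c, d} : Finset W)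
    (Finset.card_le_four.trans_lt hn)
  obtain ⟨u, hu, v, hv, huv⟩ := exists_adj_notMem hc _ (Finset.mem_insert_self a _) hw
  simp only [Finset.mem_insert, Finset.mem_singleton, not_or] at hu hv
  obtain ⟨hva, hvb, hvc, hvd⟩ := hv
  have := hab.ne
  have := hbc.ne
  have := hcd.ne
  have := hda.ne
  rcases hu with rfl | rfl | rfl | rfl
  · exact hK.not_path huv.symm hab hbc hcd hvb hvc hvd hac hda.ne' hbd
  · exact hK.not_path huv.symm hbc hcd hda hvc hvd hva hbd hab.ne' hac.symm
  · exact hK.not_path huv.symm hcd hda hab hvd hva hvb hac.symm hbc.ne' hbd.symm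
  · exact hK.not_path huv.symm hda hab hbc hva hvb hvc hbd.symm hcd.ne' hac

lemma NoP5.card_edgeFinset_le_of_triangle (hK : NoP5 K) (hc : K.Connected)
    (hn : 5 ≤ Fintype.card W) {a b c d : W} (hab : K.Adj a b) (hbc : K.Adj b c)
    (hac : K.Adj a c) (had : K.Adj a d) (hdb : d ≠ b) (hdc : d ≠ c) :
    K.edgeFinset.card ≤ Fintype.card W := by
  have hb (v : W) (hv : K.Adj b v) : v = a ∨ v = c := by
    by_contra! h
    by_cases hvd : v = d
    · subst hvd
      exact hK.not_cycle_four hc hn had hv.symm hbc hac.symm hab.ne hdc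
    · exact hK.not_path had.symm hac hbc.symm hv hdc hdb (Ne.symm hvd) hab.ne h.1.symm h.2.symm
  have hcc (v : W) (hv : K.Adj c v) : v = a ∨ v = b := by
    by_contra! h
    by_cases hvd : v = d
    · subst hvd
      exact hK.not_cycle_four hc hn had hv.symm hbc.symm hab.symm hac.ne hdb
    · exact hK.not_path had.symm hab hbc hv hdb hdc (Ne.symm hvd) hac.ne h.1.symm h.2.symm
  have hout (v w : W) (hav : K.Adj a v) (hvw : K.Adj v w) (hwa : w ≠ a) :
      s(v, w) = s(b, c) := by
    by_cases hvb : v = b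
    · subst hvb
      rw [(hb w hvw).resolve_left hwa]
    by_cases hvc : v = c
    · subst hvc
      rw [(hcc w hvw).resolve_left hwa, Sym2.eq_swap]
    have hwb : w ≠ b := by
      rintro rfl
      exact (hb v hvw.symm).elim hav.ne' hvc
    have hwc : w ≠ c := by
      rintro rfl
      exact (hcc v hvw.symm).elim hav.ne' hvb
    exact (hK.not_path hvw.symm hav.symm hab hbc hwa hwb hwc hvb hvc hac.ne).elim
  have hall (v : W) (hv : v ≠ a) : K.Adj a v := by
    by_contra hav
    obtain ⟨u, hu, w, hw, huw⟩ := exists_adj_notMem hc (insert a (K.neighborFinset a))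
      (Finset.mem_insert_self a _) (b := v) (by simp [hv, hav])
    simp only [Finset.mem_insert, mem_neighborFinset, not_or] at hu hw
    rcases hu with rfl | hu
    · exact hw.2 huw
    · rcases Sym2.eq_iff.1 (hout u w hu huw hw.1) with ⟨-, rfl⟩ | ⟨-, rfl⟩
      · exact hw.2 hac
      · exact hw.2 hab
  have hsub : K.edgeFinset ⊆
      insert s(b, c) ((Finset.univ.erase a).image fun v => s(a, v)) := by
    intro e
    induction e with
    | h v w =>
      intro he
      rw [mem_edgeFinset, mem_edgeSet] at he
      rw [Finset.mem_insert, Finset.mem_image]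
      by_cases hv : v = a
      · subst hv
        exact Or.inr ⟨w, by simp [he.ne'], rfl⟩
      by_cases hw : w = a
      · subst hw
        exact Or.inr ⟨v, by simp [hv], Sym2.eq_swap⟩
      exact Or.inl (hout v w (hall v hv) he hw)
  have h1 := (Finset.card_le_card hsub).trans (Finset.card_insert_le _ _)
  have h2 := Finset.card_image_le (s := Finset.univ.erase a) (f := fun v => s(a, v))
  rw [Finset.card_erase_of_mem (Finset.mem_univ a), Finset.card_univ] at h2
  omega

lemma NoP5.card_edgeFinset_le (hK : NoP5 K) (hc : K.Connected) (hn : 5 ≤ Fintype.card W) :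
    K.edgeFinset.card ≤ Fintype.card W := by
  by_cases hac : K.IsAcyclic
  · have := (IsTree.mk hc hac).card_edgeFinset
    omega
  simp only [IsAcyclic, not_forall, not_not] at hac
  obtain ⟨v, p, hp⟩ := hac
  have hadj (i : ℕ) (hi : i < p.length) : K.Adj (p.getVert i) (p.getVert (i + 1)) :=
    p.adj_getVert_succ hi
  have hne (i j : ℕ) (hi : i < p.length) (hj : j < p.length) (hij : i ≠ j) :
      p.getVert i ≠ p.getVert j := fun h =>
    hij (hp.getVert_injOn' (by simp; omega) (by simp; omega) h)
  have hend : p.getVert p.length = p.getVert 0 := by simp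
  have h3 := hp.three_le_length
  obtain h | h | h : p.length = 3 ∨ p.length = 4 ∨ 5 ≤ p.length := by omega
  · have h01 := hadj 0 (by omega)
    have h12 := hadj 1 (by omega)
    have h20 := hadj 2 (by omega)
    rw [show 2 + 1 = p.length by omega, hend] at h20
    obtain ⟨w, hw⟩ := exists_notMem_of_card_lt
      ({p.getVert 0, p.getVert 1, p.getVert 2} : Finset W) (Finset.card_le_three.trans_lt (by omega))
    obtain ⟨u, hu, d, hd, hud⟩ := exists_adj_notMem hc _ (Finset.mem_insert_self _ _) hw
    simp only [Finset.mem_insert, Finset.mem_singleton, not_or] at hu hd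
    rcases hu with rfl | rfl | rfl
    · exact hK.card_edgeFinset_le_of_triangle hc hn h01 h12 h20.symm hud hd.2.1 hd.2.2
    · exact hK.card_edgeFinset_le_of_triangle hc hn h12 h20 h01.symm hud hd.2.2 hd.1
    · exact hK.card_edgeFinset_le_of_triangle hc hn h20 h01 h12.symm hud hd.1 hd.2.1
  · have h30 := hadj 3 (by omega)
    rw [show 3 + 1 = p.length by omega, hend] at h30
    exact (hK.not_cycle_four hc hn (hadj 0 (by omega)) (hadj 1 (by omega)) (hadj 2 (by omega)) h30
      (hne _ _ (by omega) (by omega) (by omega)) (hne _ _ (by omega) (by omega) (by omega))).elim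
  · refine (hK.not_path (hadj 0 (by omega)) (hadj 1 (by omega)) (hadj 2 (by omega))
      (hadj 3 (by omega)) ?_ ?_ ?_ ?_ ?_ ?_).elim <;>
    exact hne _ _ (by omega) (by omega) (by omega)

lemma NoP5.sum_weight_gt (hK : NoP5 K) (hc : K.Connected) [Nontrivial W] (y : W → ℝ)
    (hy0 : ∀ w, 0 ≤ y w) (hy1 : ∀ w, y w ≤ 1)
    (hpos : 0 < ∑ w, ((K.degree w : ℝ) - 1) * y w - K.edgeFinset.card) :
    5 / 2 < ∑ w, y w := by
  have hdeg (w : W) : 1 ≤ K.degree w := hc.preconnected.degree_pos_of_nontrivial w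
  have hle : ∑ w, ((K.degree w : ℝ) - 1) * y w ≤ ∑ w, ((K.degree w : ℝ) - 1) := by
    refine Finset.sum_le_sum fun w _ => mul_le_of_le_one_right ?_ (hy1 w)
    have : (1 : ℝ) ≤ K.degree w := by exact_mod_cast hdeg w
    linarith
  have hsum : ∑ w, ((K.degree w : ℝ) - 1) = 2 * K.edgeFinset.card - Fintype.card W := by
    rw [Finset.sum_sub_distrib, ← Nat.cast_sum, sum_degrees_eq_twice_card_edges]
    simp
  have hcard : Fintype.card W < K.edgeFinset.card := by
    have : (Fintype.card W : ℝ) < K.edgeFinset.card := by linarith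
    exact_mod_cast this
  have hn : Fintype.card W ≤ 4 := by
    by_contra! h
    exact (hK.card_edgeFinset_le hc h).not_gt hcard
  have hchoose := K.card_edgeFinset_le_card_choose_two
  have he : 5 ≤ K.edgeFinset.card := by
    rw [Nat.choose_two_right] at hchoose
    generalize Fintype.card W = n at *
    interval_cases n <;> omega
  have hle2 : ∑ w, ((K.degree w : ℝ) - 1) * y w ≤ ∑ w, 2 * y w := by
    refine Finset.sum_le_sum fun w _ => mul_le_mul_of_nonneg_right ?_ (hy0 w)
    have h := K.degree_lt_card_verts w
    have : (K.degree w : ℝ) ≤ 3 := by exact_mod_cast (by omega : K.degree w ≤ 3)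
    linarith
  rw [← Finset.mul_sum] at hle2
  have : (5 : ℝ) ≤ K.edgeFinset.card := by exact_mod_cast he
  linarith

lemma gamma_range_embedding {V : Type*} [Fintype V] {G : SimpleGraph V} (f : K ↪g G)
    (x : V → ℝ) (u : V) :
    gamma G x u (Set.range f) =
      ∑ w, ((K.degree w : ℝ) - 1) * (x (f w) / x u) - K.edgeFinset.card := by
  have hd (w : W) : dS G (Set.range f) (f w) = K.degree w := by
    have : G.neighborSet (f w) ∩ Set.range f = f '' K.neighborSet w := by
      ext v
      constructor
      · rintro ⟨hv, z, rfl⟩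
        exact ⟨z, f.map_adj_iff.1 hv, rfl⟩
      · rintro ⟨z, hz, rfl⟩
        exact ⟨f.map_adj_iff.2 hz, z, rfl⟩
    rw [dS, this, Set.ncard_image_of_injective _ f.injective, ← card_neighborSet_eq_degree,
      Set.ncard_eq_toFinset_card', Set.toFinset_card]
  have he : eIn G (Set.range f) = K.edgeFinset.card := by
    have : {e ∈ G.edgeSet | ∀ v ∈ e, v ∈ Set.range f} = Sym2.map f '' K.edgeSet := by
      ext e
      induction e with
      | h v w =>
        constructor
        · rintro ⟨hvw, h⟩
          obtain ⟨a, rfl⟩ := h v (Sym2.mem_mk_left _ _)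
          obtain ⟨b, rfl⟩ := h w (Sym2.mem_mk_right _ _)
          exact ⟨s(a, b), f.map_adj_iff.1 hvw, rfl⟩
        · rintro ⟨e, he, h⟩
          rw [← h]
          induction e with
          | h a b =>
            refine ⟨f.map_adj_iff.2 he, fun v hv => ?_⟩
            rcases Sym2.mem_iff.1 hv with rfl | rfl <;> exact Set.mem_range_self _
    rw [eIn, this, Set.ncard_image_of_injective _ (Sym2.map.injective f.injective),
      ← coe_edgeFinset, Set.ncard_coe_finset]
  have hS (inst : Fintype (Set.range f)) :
      @Set.toFinset _ (Set.range f) inst = Finset.univ.map f.toEmbedding := by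
    ext v
    simp
  rw [gamma, he, hS, Finset.sum_map]
  congr 1
  exact Finset.sum_congr rfl fun w _ => by
    rw [← hd w]
    rfl

end Finite

theorem stmt_11 
    {V : Type} [Fintype V] [DecidableEq V] (G : SimpleGraph V) [DecidableRel G.Adj]
    (m : ℕ) (hm : 88 ≤ m)
    (hfree : F6Free G)
    (hcard : G.edgeSet.ncard = m)
    (hnoiso : ∀ v : V, ∃ w, G.Adj v w)
    (hmax : ∀ (n : ℕ) (G' : SimpleGraph (Fin n)), F6Free G' → G'.edgeSet.ncard = m →
      (∀ v, ∃ w, G'.Adj v w) → specRad G' ≤ specRad G)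
    (lam : ℝ) (hlam : lam = specRad G)
    (hconn : G.Connected)
    (hlow : (1 + Real.sqrt (4 * (m : ℝ) - 3)) / 2 ≤ lam)
    (x : V → ℝ) (hxpos : ∀ v, 0 < x v)
    (heig : (G.adjMatrix ℝ).mulVec x = lam • x)
    (ustar : V) (hustar : ∀ v, x v ≤ x ustar)
    :
    ({C : (G.induce (G.neighborSet ustar)).ConnectedComponent |
        (∃ a b, a ∈ C.supp ∧ b ∈ C.supp ∧ (G.induce (G.neighborSet ustar)).Adj a b) ∧
          0 < gamma G x ustar (Subtype.val '' C.supp)}.ncard : ℝ)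
      < 2 / 5 * lam + 7 / 10 := by
  set K := G.induce (G.neighborSet ustar)
  have hx0 := hxpos ustar
  have hKP : NoP5 K := hfree.noP5_induce ustar
  have hlam : 0 < lam := lt_of_lt_of_le (by positivity) hlow
  have hsum : ∑ u : G.neighborSet ustar, x u / x ustar = lam := by
    have h := congrFun heig ustar
    rw [adjMatrix_mulVec_apply, Pi.smul_apply, smul_eq_mul] at h
    rw [← Finset.sum_div, div_eq_iff hx0.ne', ← h]
    exact (Finset.sum_subtype (G.neighborFinset ustar) (fun v => by simp) x).symm
  have hcomp (C : K.ConnectedComponent)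
      (hC : (∃ a b, a ∈ C.supp ∧ b ∈ C.supp ∧ K.Adj a b) ∧
        0 < gamma G x ustar (Subtype.val '' C.supp)) :
      5 / 2 ≤ ∑ u with K.connectedComponentMk u = C, x u / x ustar := by
    obtain ⟨⟨a, b, ha, hb, hab⟩, hg⟩ := hC
    have hnt : Nontrivial C.supp :=
      ⟨⟨a, ha⟩, ⟨b, hb⟩, fun h => hab.ne (congrArg Subtype.val h)⟩
    have hconnC : (K.induce C.supp).Connected := C.connected_toSimpleGraph
    let f : K.induce C.supp ↪g K := Embedding.induce C.supp
    let g : K ↪g G := Embedding.induce (G.neighborSet ustar)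
    have hrange : Subtype.val '' C.supp = Set.range (g.comp f) := by
      ext v
      constructor
      · rintro ⟨w, hw, rfl⟩
        exact ⟨⟨w, hw⟩, rfl⟩
      · rintro ⟨w, rfl⟩
        exact ⟨w, w.2, rfl⟩
    rw [hrange, gamma_range_embedding] at hg
    have h := (hKP.comap f).sum_weight_gt hconnC _ (fun w => (div_pos (hxpos _) hx0).le)
      (fun w => (div_le_one hx0).2 (hustar _)) hg
    refine h.le.trans_eq ?_
    exact (Finset.sum_subtype _ (fun v => by simp [ConnectedComponent.mem_supp_iff])
      (fun v : G.neighborSet ustar => x v / x ustar)).symm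
  rw [Set.ncard_eq_toFinset_card']
  set T := Set.toFinset {C : K.ConnectedComponent |
        (∃ a b, a ∈ C.supp ∧ b ∈ C.supp ∧ K.Adj a b) ∧
          0 < gamma G x ustar (Subtype.val '' C.supp)} with hT
  have h1 : (T.card : ℝ) * (5 / 2) ≤
      ∑ C ∈ T, ∑ u with K.connectedComponentMk u = C, x u / x ustar := by
    rw [← nsmul_eq_mul]
    exact Finset.card_nsmul_le_sum _ _ _ fun C hC => hcomp C (by simpa [hT] using hC)
  have h2 : ∑ C ∈ T, ∑ u with K.connectedComponentMk u = C, x u / x ustar ≤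
      ∑ u : G.neighborSet ustar, x u / x ustar := by
    rw [← Finset.sum_fiberwise Finset.univ K.connectedComponentMk]
    exact Finset.sum_le_sum_of_subset_of_nonneg (Finset.subset_univ _) fun C _ _ =>
      Finset.sum_nonneg fun u _ => (div_pos (hxpos _) hx0).le
  linarith
end

section
/- Under the setup, no component of the induced subgraph G*[U] is isomorphic to K_4 − e (the complete graph on 4 vertices minus one edge). -/
open SimpleGraph Finset
open scoped Classical

/-- `G` contains no fan on a hub `h` and a path `p₁p₂p₃p₄p₅`. -/
theorem F6Free.not_fan {V : Type*} {G : SimpleGraph V} (hG : F6Free G) {h p₁ p₂ p₃ p₄ p₅ : V}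
    (h₁ : G.Adj h p₁) (h₂ : G.Adj h p₂) (h₃ : G.Adj h p₃) (h₄ : G.Adj h p₄) (h₅ : G.Adj h p₅)
    (h₁₂ : G.Adj p₁ p₂) (h₂₃ : G.Adj p₂ p₃) (h₃₄ : G.Adj p₃ p₄) (h₄₅ : G.Adj p₄ p₅)
    (n₁₃ : p₁ ≠ p₃) (n₁₄ : p₁ ≠ p₄) (n₁₅ : p₁ ≠ p₅) (n₂₄ : p₂ ≠ p₄) (n₂₅ : p₂ ≠ p₅)
    (n₃₅ : p₃ ≠ p₅) : False := by
  refine hG ⟨⟨![p₁, p₂, p₃, p₄, p₅, h], ?_⟩, ?_⟩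
  · intro i j hij
    have := h₁.symm; have := h₂.symm; have := h₃.symm; have := h₄.symm; have := h₅.symm
    have := h₁₂.symm; have := h₂₃.symm; have := h₃₄.symm; have := h₄₅.symm
    fin_cases i <;> fin_cases j <;> first | assumption | simp [fan6] at hij
  · have := h₁.ne; have := h₂.ne; have := h₃.ne; have := h₄.ne; have := h₅.ne
    have := h₁₂.ne; have := h₂₃.ne; have := h₃₄.ne; have := h₄₅.ne
    intro i j hij
    change (![p₁, p₂, p₃, p₄, p₅, h] : Fin 6 → V) i = ![p₁, p₂, p₃, p₄, p₅, h] j at hij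
    fin_cases i <;> fin_cases j <;> simp_all [eq_comm]

/-- The vertex set `U` spans no path on five vertices in `G`. -/
def PathFiveFreeOn {V : Type*} (G : SimpleGraph V) (U : Finset V) : Prop :=
  ∀ p₁ ∈ U, ∀ p₂ ∈ U, ∀ p₃ ∈ U, ∀ p₄ ∈ U, ∀ p₅ ∈ U,
    G.Adj p₁ p₂ → G.Adj p₂ p₃ → G.Adj p₃ p₄ → G.Adj p₄ p₅ →
    p₁ ≠ p₃ → p₁ ≠ p₄ → p₁ ≠ p₅ → p₂ ≠ p₄ → p₂ ≠ p₅ → p₃ ≠ p₅ → False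

/-- `B` is a set of four vertices of `U` spanning at least a `K₄ - e`, with no further
neighbours in `U`. -/
def IsDiamondIn {V : Type*} (G : SimpleGraph V) (U B : Finset V) : Prop :=
  (∃ a b c d, B = {a, b, c, d} ∧ G.Adj a b ∧ G.Adj a c ∧ G.Adj a d ∧ G.Adj b c ∧ G.Adj b d ∧
    c ≠ d) ∧ B ⊆ U ∧ ∀ v ∈ B, ∀ u ∈ U, G.Adj v u → u ∈ B

section Local

variable {V : Type*} {G : SimpleGraph V} {U : Finset V}

theorem PathFiveFreeOn.eq_or_eq_of_adj (hP : PathFiveFreeOn G U) {u p q s p' q' : V}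
    (hu : u ∈ U) (hp : p ∈ U) (hq : q ∈ U) (hs : s ∈ U) (hp' : p' ∈ U) (hq' : q' ∈ U)
    (up : G.Adj u p) (uq : G.Adj u q) (us : G.Adj u s) (hpq : p ≠ q) (hps : p ≠ s) (hqs : q ≠ s)
    (pp : G.Adj p p') (qq : G.Adj q q') (np : p' ≠ u) (nq : q' ≠ u) : p' = q ∨ p' = s := by
  by_contra! h
  obtain ⟨h1, h2⟩ := h
  by_cases e1 : q' = p
  · subst e1
    exact hP p' hp' _ hp q hq u hu s hs pp.symm qq.symm uq.symm us h1 np h2 up.ne' hps hqs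
  by_cases e2 : q' = p'
  · subst e2
    exact hP p hp _ hp' q hq u hu s hs pp qq.symm uq.symm us hpq up.ne' hps np h2 hqs
  exact hP p' hp' p hp u hu q hq q' hq' pp.symm up.symm uq qq np h1 (Ne.symm e2) hpq
    (Ne.symm e1) nq.symm

/-- In a graph without paths on five vertices, a vertex with three neighbours of degree at least
two lies in a component that is `K₄` or `K₄ - e`. -/
theorem PathFiveFreeOn.exists_isDiamondIn (hP : PathFiveFreeOn G U) {u p q s p' q' s' : V}
    (hu : u ∈ U) (hp : p ∈ U) (hq : q ∈ U) (hs : s ∈ U) (hp' : p' ∈ U) (hq' : q' ∈ U)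
    (hs' : s' ∈ U) (up : G.Adj u p) (uq : G.Adj u q) (us : G.Adj u s)
    (hpq : p ≠ q) (hps : p ≠ s) (hqs : q ≠ s)
    (pp : G.Adj p p') (qq : G.Adj q q') (ss : G.Adj s s')
    (np : p' ≠ u) (nq : q' ≠ u) (ns : s' ≠ u) : ∃ B, IsDiamondIn G U B ∧ u ∈ B := by
  have key : ∀ b c d, b ∈ U → c ∈ U → d ∈ U → G.Adj u b → G.Adj u c → G.Adj u d →
      G.Adj b c → G.Adj b d → c ≠ d → ∃ B, IsDiamondIn G U B ∧ u ∈ B := by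
    intro b c d hb hc hd ub uc ud bc bd hcd
    refine ⟨{u, b, c, d}, ⟨⟨u, b, c, d, rfl, ub, uc, ud, bc, bd, hcd⟩, ?_, ?_⟩, by simp⟩
    · intro v hv
      simp only [Finset.mem_insert, Finset.mem_singleton] at hv
      rcases hv with rfl | rfl | rfl | rfl <;> assumption
    · intro v hv y hy hvy
      by_contra hny
      simp only [Finset.mem_insert, Finset.mem_singleton, not_or] at hv hny
      obtain ⟨n1, n2, n3, n4⟩ := hny
      rcases hv with rfl | rfl | rfl | rfl
      · exact hP y hy _ hu c hc b hb d hd hvy.symm uc bc.symm bd n3 n2 n4 ub.ne ud.ne hcd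
      · rcases hP.eq_or_eq_of_adj hu hb hc hd hy hb ub uc ud bc.ne bd.ne hcd hvy bc.symm n1 ub.ne'
          with h | h <;> contradiction
      · rcases hP.eq_or_eq_of_adj hu hc hb hd hy hc uc ub ud bc.ne' hcd bd.ne hvy bc n1 uc.ne'
          with h | h <;> contradiction
      · rcases hP.eq_or_eq_of_adj hu hd hb hc hy hd ud ub uc bd.ne' hcd.symm bc.ne hvy bd n1 ud.ne'
          with h | h <;> contradiction
  rcases hP.eq_or_eq_of_adj hu hp hq hs hp' hq' up uq us hpq hps hqs pp qq np nq with rfl | rfl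
  · rcases hP.eq_or_eq_of_adj hu hs hp hq hs' hp' us up uq hps.symm hqs.symm hpq ss pp ns np
      with rfl | rfl
    · exact key _ _ _ hp hq hs up uq us pp ss.symm hqs
    · exact key _ _ _ hq hp hs uq up us pp.symm ss.symm hps
  · rcases hP.eq_or_eq_of_adj hu hq hp hs hq' hp' uq up us hpq.symm hqs hps qq pp nq np
      with rfl | rfl
    · exact key _ _ _ hp hq hs up uq us qq.symm pp hqs
    · exact key _ _ _ hs hp hq us up uq pp.symm qq.symm hpq

theorem IsDiamondIn.subset_of_mem {B B' : Finset V} (hB : IsDiamondIn G U B)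
    (hB' : IsDiamondIn G U B') {v : V} (hv : v ∈ B) (hv' : v ∈ B') : B ⊆ B' := by
  obtain ⟨⟨a, b, c, d, rfl, ab, ac, ad, bc, bd, -⟩, hU, -⟩ := hB
  have cl := hB'.2.2
  have mU : ∀ y ∈ ({a, b, c, d} : Finset V), y ∈ U := fun y hy => hU hy
  have ha := mU a (by simp)
  have hb := mU b (by simp)
  have hc := mU c (by simp)
  have hd := mU d (by simp)
  have main : a ∈ B' → ({a, b, c, d} : Finset V) ⊆ B' := by
    intro h y hy
    simp only [Finset.mem_insert, Finset.mem_singleton] at hy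
    rcases hy with rfl | rfl | rfl | rfl
    · exact h
    · exact cl a h _ hb ab
    · exact cl a h _ hc ac
    · exact cl a h _ hd ad
  simp only [Finset.mem_insert, Finset.mem_singleton] at hv
  rcases hv with rfl | rfl | rfl | rfl
  · exact main hv'
  · exact main (cl _ hv' _ ha ab.symm)
  · exact main (cl _ hv' _ ha ac.symm)
  · exact main (cl _ hv' _ ha ad.symm)

theorem IsDiamondIn.eq_of_mem {B B' : Finset V} (hB : IsDiamondIn G U B)
    (hB' : IsDiamondIn G U B') {v : V} (hv : v ∈ B) (hv' : v ∈ B') : B = B' :=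
  (hB.subset_of_mem hB' hv hv').antisymm (hB'.subset_of_mem hB hv' hv)

end Local

/-- The `0`-`1` indicator of adjacency, as a real number. -/
noncomputable def adjInd {V : Type*} (G : SimpleGraph V) (u v : V) : ℝ :=
  if G.Adj u v then 1 else 0

/-- The number of neighbours of `v` in `S`, as a real number. -/
noncomputable def degIn {V : Type*} (G : SimpleGraph V) (S : Finset V) (v : V) : ℝ :=
  ∑ u ∈ S, adjInd G v u

/-- The contribution of a vertex of `U` to `γ(G[U])`, each edge being shared equally between
its ends. -/
noncomputable def charge {V : Type*} (G : SimpleGraph V) (U : Finset V) (x : V → ℝ) (v : V) : ℝ :=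
  (degIn G U v - 1) * x v - degIn G U v / 2

section Weights

variable {V : Type*} {G : SimpleGraph V}

theorem adjInd_comm (u v : V) : adjInd G u v = adjInd G v u := by
  simp [adjInd, G.adj_comm]

theorem adjInd_of_adj {u v : V} (h : G.Adj u v) : adjInd G u v = 1 := by simp [adjInd, h]

theorem adjInd_of_not_adj {u v : V} (h : ¬ G.Adj u v) : adjInd G u v = 0 := by simp [adjInd, h]

theorem adjInd_nonneg (u v : V) : 0 ≤ adjInd G u v := by
  unfold adjInd; split_ifs <;> norm_num

theorem adjInd_le_one (u v : V) : adjInd G u v ≤ 1 := by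
  unfold adjInd; split_ifs <;> norm_num

theorem degIn_nonneg (S : Finset V) (v : V) : 0 ≤ degIn G S v :=
  Finset.sum_nonneg fun _ _ => adjInd_nonneg _ _

theorem degIn_eq_card (S : Finset V) (v : V) : degIn G S v = #{u ∈ S | G.Adj v u} := by
  simp [degIn, adjInd]

theorem one_le_degIn {S : Finset V} {u v : V} (hu : u ∈ S) (h : G.Adj v u) :
    1 ≤ degIn G S v := by
  rw [← adjInd_of_adj h]
  exact Finset.single_le_sum (f := fun u => adjInd G v u) (fun _ _ => adjInd_nonneg _ _) hu

theorem sum_sum_adjInd_mul (S T : Finset V) (f : V → ℝ) :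
    ∑ u ∈ S, ∑ v ∈ T, adjInd G u v * f v = ∑ v ∈ T, degIn G S v * f v := by
  rw [Finset.sum_comm]
  refine Finset.sum_congr rfl fun v _ => ?_
  rw [degIn, Finset.sum_mul]
  exact Finset.sum_congr rfl fun u _ => by rw [adjInd_comm]

theorem two_mul_ncard_edgeSet [Fintype V] :
    2 * (G.edgeSet.ncard : ℝ) = ∑ v, degIn G univ v := by
  have h := G.sum_degrees_eq_twice_card_edges
  have h2 : G.edgeSet.ncard = #G.edgeFinset := by
    rw [← SimpleGraph.coe_edgeFinset, Set.ncard_coe_finset]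
  rw [h2]
  have h3 : ∀ v, degIn G univ v = (G.degree v : ℝ) := by
    intro v
    rw [degIn_eq_card, ← SimpleGraph.card_neighborFinset_eq_degree,
      SimpleGraph.neighborFinset_eq_filter]
  simp only [h3]
  exact_mod_cast h.symm

end Weights

/-- `x` is a `lam`-eigenvector of `G`, with all entries in `(0, 1]` and entry `1` at `r`;
`U` is the neighbourhood of `r` and `W` the set of vertices at distance at least two. -/
structure IsRootedEigenvector {V : Type*} [Fintype V] (G : SimpleGraph V) (lam : ℝ) (x : V → ℝ)
    (r : V) (U W : Finset V) : Prop where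
  pos : ∀ v, 0 < x v
  le_one : ∀ v, x v ≤ 1
  root : x r = 1
  eigen : ∀ v, lam * x v = ∑ u, adjInd G v u * x u
  mem_U : ∀ v, v ∈ U ↔ G.Adj r v
  mem_W : ∀ v, v ∈ W ↔ v ≠ r ∧ ¬ G.Adj r v

namespace IsRootedEigenvector

variable {V : Type*} [Fintype V] {G : SimpleGraph V} {lam : ℝ} {x : V → ℝ} {r : V}
  {U W : Finset V}

theorem sum_univ (h : IsRootedEigenvector G lam x r U W) (f : V → ℝ) :
    ∑ v, f v = f r + ∑ v ∈ U, f v + ∑ v ∈ W, f v := by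
  have hrU : r ∉ U := by simp [h.mem_U]
  have hd : Disjoint (insert r U) W := by
    rw [Finset.disjoint_left]
    intro v hv hw
    rw [Finset.mem_insert, h.mem_U] at hv
    have := (h.mem_W v).1 hw
    tauto
  have hu : (univ : Finset V) = insert r U ∪ W := by
    ext v
    simp only [Finset.mem_univ, Finset.mem_union, Finset.mem_insert, h.mem_U, h.mem_W, true_iff]
    tauto
  rw [hu, Finset.sum_union hd, Finset.sum_insert hrU]

theorem lam_eq (h : IsRootedEigenvector G lam x r U W) : lam = ∑ v ∈ U, x v := by
  have h1 := h.eigen r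
  rw [h.root, mul_one, h.sum_univ] at h1
  rw [h1, adjInd_of_not_adj (G.irrefl), Finset.sum_congr rfl fun v hv =>
    by rw [adjInd_of_adj ((h.mem_U v).1 hv), one_mul], Finset.sum_eq_zero (s := W) fun v hv =>
    by rw [adjInd_of_not_adj ((h.mem_W v).1 hv).2, zero_mul]]
  ring

theorem eigen_U (h : IsRootedEigenvector G lam x r U W) {v : V} (hv : v ∈ U) :
    lam * x v = 1 + ∑ u ∈ U, adjInd G v u * x u + ∑ w ∈ W, adjInd G v w * x w := by
  rw [h.eigen, h.sum_univ, adjInd_of_adj ((h.mem_U v).1 hv).symm, h.root, one_mul]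

theorem eigen_W (h : IsRootedEigenvector G lam x r U W) {w : V} (hw : w ∈ W) :
    lam * x w = ∑ u ∈ U, adjInd G w u * x u + ∑ u ∈ W, adjInd G w u * x u := by
  rw [h.eigen, h.sum_univ, adjInd_of_not_adj fun e => ((h.mem_W w).1 hw).2 e.symm]
  ring

theorem sq_lam (h : IsRootedEigenvector G lam x r U W) :
    lam ^ 2 = #U + ∑ v ∈ U, degIn G U v * x v + ∑ w ∈ W, degIn G U w * x w := by
  have h1 : lam ^ 2 = ∑ v ∈ U, lam * x v := by
    rw [← Finset.mul_sum, ← h.lam_eq, sq]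
  rw [h1, Finset.sum_congr rfl fun v hv => h.eigen_U hv, Finset.sum_add_distrib,
    Finset.sum_add_distrib, sum_sum_adjInd_mul, sum_sum_adjInd_mul]
  simp

theorem two_mul_edges (h : IsRootedEigenvector G lam x r U W) :
    2 * (G.edgeSet.ncard : ℝ) = 2 * #U + ∑ v ∈ U, degIn G U v + 2 * ∑ w ∈ W, degIn G U w
      + ∑ w ∈ W, degIn G W w := by
  have key : ∀ v, degIn G univ v = adjInd G v r + degIn G U v + degIn G W v := fun v =>
    h.sum_univ _
  have h1 : degIn G U r = #U := by
    rw [degIn, Finset.sum_congr rfl fun v hv => adjInd_of_adj ((h.mem_U v).1 hv)]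
    simp
  have h2 : degIn G W r = 0 :=
    Finset.sum_eq_zero fun v hv => adjInd_of_not_adj ((h.mem_W v).1 hv).2
  have h3 : ∑ v ∈ U, adjInd G v r = #U := by
    rw [← h1]; exact Finset.sum_congr rfl fun v _ => adjInd_comm _ _
  have h4 : ∑ v ∈ W, adjInd G v r = 0 := by
    rw [← h2]; exact Finset.sum_congr rfl fun v _ => adjInd_comm _ _
  have h5 : ∑ v ∈ U, degIn G W v = ∑ w ∈ W, degIn G U w := by
    simpa [degIn] using sum_sum_adjInd_mul (G := G) U W fun _ => 1
  rw [two_mul_ncard_edgeSet, h.sum_univ, key, Finset.sum_congr rfl fun v _ => key v,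
    Finset.sum_congr (s₁ := W) rfl fun v _ => key v]
  simp only [Finset.sum_add_distrib, h1, h2, h3, h4, h5, adjInd_of_not_adj (G.irrefl (v := r))]
  ring

theorem sum_W_le (h : IsRootedEigenvector G lam x r U W)
    (hm : (G.edgeSet.ncard : ℝ) - 1 ≤ lam ^ 2 - lam) :
    ∑ w ∈ W, (degIn G W w / 2 + degIn G U w * (1 - x w)) ≤ ∑ v ∈ U, charge G U x v + 1 := by
  have h1 := h.sq_lam
  have h2 := h.two_mul_edges
  have h3 := h.lam_eq
  simp only [charge, mul_sub, sub_mul, Finset.sum_add_distrib, Finset.sum_sub_distrib, one_mul,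
    mul_one, ← Finset.sum_div]
  linarith

end IsRootedEigenvector

theorem charge_le {V : Type*} {G : SimpleGraph V} {U : Finset V} {x : V → ℝ}
    (hx1 : ∀ v, x v ≤ 1) {v : V} (h : 1 ≤ degIn G U v) :
    charge G U x v ≤ degIn G U v / 2 - 1 := by
  have := hx1 v
  unfold charge
  nlinarith

section Charge

variable {V : Type*} {G : SimpleGraph V} {U : Finset V} {x : V → ℝ}

/-- A vertex outside all diamonds has charge at most half its number of leaf neighbours,
and `1/2` less than that if it is itself a leaf. -/
theorem PathFiveFreeOn.charge_le_leaves (hP : PathFiveFreeOn G U) (hx0 : ∀ v, 0 < x v)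
    (hx1 : ∀ v, x v ≤ 1) {u : V} (hu : u ∈ U) (hnot : ∀ B, IsDiamondIn G U B → u ∉ B) :
    charge G U x u ≤ (∑ v ∈ U, adjInd G u v * (if degIn G U v = 1 then 1 else 0)
      - if degIn G U u = 1 then 1 else 0) / 2 := by
  have hl : 0 ≤ ∑ v ∈ U, adjInd G u v * (if degIn G U v = 1 then (1 : ℝ) else 0) :=
    Finset.sum_nonneg fun v _ => mul_nonneg (adjInd_nonneg _ _) (by split_ifs <;> norm_num)
  by_cases h1 : degIn G U u = 1
  · have := charge_le hx1 h1.ge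
    rw [if_pos h1]
    linarith
  rw [if_neg h1]
  by_cases h0 : degIn G U u = 0
  · have := hx0 u
    simp only [charge, h0]
    linarith
  have hge : 1 ≤ degIn G U u := by
    rw [degIn_eq_card] at h0 ⊢
    exact_mod_cast Nat.one_le_iff_ne_zero.2 (by exact_mod_cast h0)
  have hc := charge_le hx1 hge
  set N : Finset V := {v ∈ U | G.Adj u v ∧ degIn G U v ≠ 1} with hN
  have hsplit : degIn G U u = ∑ v ∈ U, adjInd G u v * (if degIn G U v = 1 then 1 else 0) + #N := by
    have : (#N : ℝ) = ∑ v ∈ U, adjInd G u v * (if degIn G U v = 1 then 0 else 1) := by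
      rw [hN, Finset.card_filter]
      push_cast
      refine Finset.sum_congr rfl fun v _ => ?_
      by_cases e1 : G.Adj u v <;> by_cases e2 : degIn G U v = 1 <;> simp [adjInd, e1, e2]
    rw [this, ← Finset.sum_add_distrib, degIn]
    refine Finset.sum_congr rfl fun v _ => ?_
    split_ifs <;> ring
  have hcard : #N ≤ 2 := by
    by_contra! hlt
    obtain ⟨p, q, s, hp, hq, hs, hpq, hps, hqs⟩ := Finset.two_lt_card_iff.1 hlt
    have ext : ∀ p ∈ N, p ∈ U ∧ G.Adj u p ∧ ∃ p' ∈ U, G.Adj p p' ∧ p' ≠ u := by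
      intro p hp
      obtain ⟨hpU, hup, hne⟩ := Finset.mem_filter.1 hp
      refine ⟨hpU, hup, ?_⟩
      have hmem : u ∈ U.filter (G.Adj p) := Finset.mem_filter.2 ⟨hu, hup.symm⟩
      have hone : 1 < #(U.filter (G.Adj p)) := by
        have := Finset.card_pos.2 ⟨u, hmem⟩
        rw [degIn_eq_card] at hne
        have : #(U.filter (G.Adj p)) ≠ 1 := by exact_mod_cast hne
        omega
      obtain ⟨p', hp', hne'⟩ := Finset.exists_mem_ne hone u
      exact ⟨p', (Finset.mem_filter.1 hp').1, (Finset.mem_filter.1 hp').2, hne'⟩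
    obtain ⟨hpU, up, p', hp', pp, np⟩ := ext p hp
    obtain ⟨hqU, uq, q', hq', qq, nq⟩ := ext q hq
    obtain ⟨hsU, us, s', hs', ss, ns⟩ := ext s hs
    obtain ⟨B, hB, huB⟩ := hP.exists_isDiamondIn hu hpU hqU hsU hp' hq' hs' up uq us hpq hps hqs
      pp qq ss np nq ns
    exact hnot B hB huB
  have hcard' : (#N : ℝ) ≤ 2 := by exact_mod_cast hcard
  linarith

theorem sum_adjInd_leaf_sub :
    ∑ u ∈ U, (∑ v ∈ U, adjInd G u v * (if degIn G U v = 1 then (1 : ℝ) else 0)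
      - if degIn G U u = 1 then 1 else 0) / 2 = 0 := by
  rw [← Finset.sum_div, Finset.sum_sub_distrib, sum_sum_adjInd_mul, ← Finset.sum_sub_distrib,
    Finset.sum_eq_zero, zero_div]
  intro v _
  split_ifs with h <;> simp [h]

theorem IsDiamondIn.degIn_ne_one {B : Finset V} (hB : IsDiamondIn G U B) {v : V} (hv : v ∈ B) :
    degIn G U v ≠ 1 := by
  obtain ⟨⟨a, b, c, d, rfl, ab, ac, ad, bc, bd, cd⟩, hU, -⟩ := hB
  have hmem : ∀ y, y ∈ ({a, b, c, d} : Finset V) → y ∈ U := fun y hy => hU hy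
  have ha := hmem a (by simp)
  have hb := hmem b (by simp)
  have hc := hmem c (by simp)
  have hd := hmem d (by simp)
  have key : ∀ y z, y ∈ U → z ∈ U → y ≠ z → G.Adj v y → G.Adj v z → degIn G U v ≠ 1 := by
    intro y z hy hz hne vy vz
    rw [degIn_eq_card]
    have : 1 < #{u ∈ U | G.Adj v u} :=
      Finset.one_lt_card.2 ⟨y, by simp [hy, vy], z, by simp [hz, vz], hne⟩
    exact_mod_cast this.ne'
  simp only [Finset.mem_insert, Finset.mem_singleton] at hv
  rcases hv with rfl | rfl | rfl | rfl
  · exact key c d hc hd cd ac ad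
  · exact key c d hc hd cd bc bd
  · exact key a b ha hb ab.ne ac.symm bc.symm
  · exact key a b ha hb ab.ne ad.symm bd.symm

/-- The total charge of `U` is at most the total charge of its diamonds. -/
theorem PathFiveFreeOn.sum_charge_le (hP : PathFiveFreeOn G U) (hx0 : ∀ v, 0 < x v)
    (hx1 : ∀ v, x v ≤ 1) :
    ∑ v ∈ U, charge G U x v
      ≤ ∑ B ∈ U.powerset with IsDiamondIn G U B, ∑ v ∈ B, charge G U x v := by
  set D : Finset (Finset V) := {B ∈ U.powerset | IsDiamondIn G U B} with hD
  have hDm : ∀ B, B ∈ D ↔ IsDiamondIn G U B := fun B => by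
    simp only [hD, Finset.mem_filter, Finset.mem_powerset, and_iff_right_iff_imp]
    exact fun h => h.2.1
  rw [← Finset.sum_biUnion (t := fun B : Finset V => B) (s := D) (fun B hB B' hB' hne => by
    rw [Function.onFun, Finset.disjoint_left]
    exact fun v hv hv' => hne (((hDm B).1 hB).eq_of_mem ((hDm B').1 hB') hv hv'))]
  set T := D.biUnion fun B => B with hT
  have hTU : T ⊆ U := Finset.biUnion_subset.2 fun B hB => ((hDm B).1 hB).2.1
  rw [← Finset.sum_sdiff hTU]
  set f : V → ℝ := fun u => (∑ v ∈ U, adjInd G u v * (if degIn G U v = 1 then (1 : ℝ) else 0)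
      - if degIn G U u = 1 then 1 else 0) / 2 with hf
  have h1 : ∑ v ∈ U \ T, charge G U x v ≤ ∑ v ∈ U \ T, f v := by
    refine Finset.sum_le_sum fun v hv => ?_
    rw [Finset.mem_sdiff] at hv
    exact hP.charge_le_leaves hx0 hx1 hv.1 fun B hB hvB =>
      hv.2 (Finset.mem_biUnion.2 ⟨B, (hDm B).2 hB, hvB⟩)
  have h2 : ∑ v ∈ U \ T, f v ≤ ∑ v ∈ U, f v := by
    refine Finset.sum_le_sum_of_subset_of_nonneg Finset.sdiff_subset fun v hv hv' => ?_
    have hvT : v ∈ T := by simpa [hv] using hv'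
    obtain ⟨B, hB, hvB⟩ := Finset.mem_biUnion.1 hvT
    simp only [hf, if_neg (((hDm B).1 hB).degIn_ne_one hvB), sub_zero]
    exact div_nonneg (Finset.sum_nonneg fun v _ =>
      mul_nonneg (adjInd_nonneg _ _) (by split_ifs <;> norm_num)) (by norm_num)
  have h3 : ∑ v ∈ U, f v = 0 := sum_adjInd_leaf_sub
  linarith

end Charge

theorem F6Free.not_adj_of_diamond {V : Type*} {G : SimpleGraph V} (hG : F6Free G)
    {r a b c d w : V} (ra : G.Adj r a) (rb : G.Adj r b) (rc : G.Adj r c) (rd : G.Adj r d)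
    (ab : G.Adj a b) (ac : G.Adj a c) (ad : G.Adj a d) (bc : G.Adj b c) (bd : G.Adj b d)
    (cd : c ≠ d) (hwr : w ≠ r) (hw : ¬ G.Adj r w) (wa : G.Adj w a) :
    ¬ G.Adj w b ∧ ¬ G.Adj w c ∧ ¬ G.Adj w d := by
  have hne : ∀ {y}, G.Adj r y → w ≠ y := by
    rintro y hy rfl
    exact hw hy
  refine ⟨fun wb => ?_, fun wc => ?_, fun wd => ?_⟩
  · exact hG.not_fan wa.symm ab ac ra.symm ad wb bc rc.symm rd (hne rc) hwr (hne rd) rb.ne'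
      bd.ne cd
  · exact hG.not_fan wa.symm ac ra.symm ad ab wc rc.symm rd bd.symm hwr (hne rd) (hne rb) cd
      bc.ne' rb.ne
  · exact hG.not_fan wa.symm ad ra.symm ac ab wd rd.symm rc bc.symm hwr (hne rc) (hne rb) cd.symm
      bd.ne' rb.ne

theorem exists_isDiamondIn_of_coords {V : Type*} {G : SimpleGraph V} {U : Finset V} {a b c d : V}
    (ab : G.Adj a b) (ac : G.Adj a c) (ad : G.Adj a d) (bc : G.Adj b c) (bd : G.Adj b d)
    (cd : c ≠ d) (hU : ∀ v, v = a ∨ v = b ∨ v = c ∨ v = d → v ∈ U)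
    (hcl : ∀ v, v = a ∨ v = b ∨ v = c ∨ v = d → ∀ u ∈ U, G.Adj v u →
      u = a ∨ u = b ∨ u = c ∨ u = d) : ∃ B, IsDiamondIn G U B :=
  ⟨{a, b, c, d}, ⟨a, b, c, d, rfl, ab, ac, ad, bc, bd, cd⟩, fun v hv => hU v (by simpa using hv),
    fun v hv u hu hvu => by simpa using hcl v (by simpa using hv) u hu hvu⟩

theorem IsDiamondIn.sum_adjInd_mul {V : Type*} {G : SimpleGraph V} {U B : Finset V}
    (hB : IsDiamondIn G U B) {v : V} (hv : v ∈ B) (f : V → ℝ) :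
    ∑ u ∈ U, adjInd G v u * f u = ∑ u ∈ B, adjInd G v u * f u := by
  refine (Finset.sum_subset hB.2.1 fun u hu hu' => ?_).symm
  rw [adjInd_of_not_adj fun h => hu' (hB.2.2 v hv u hu h), zero_mul]

theorem adjInd_eq_zero_or_one {V : Type*} {G : SimpleGraph V} (u v : V) :
    adjInd G u v = 0 ∨ adjInd G u v = 1 := by
  unfold adjInd; split_ifs <;> simp

theorem adjInd_add_le_one {V : Type*} {G : SimpleGraph V} {w u v : V}
    (h : G.Adj w u → ¬ G.Adj w v) : adjInd G w u + adjInd G w v ≤ 1 := by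
  by_cases hu : G.Adj w u
  · rw [adjInd_of_not_adj (h hu)]
    linarith [adjInd_le_one (G := G) w u]
  · rw [adjInd_of_not_adj hu]
    linarith [adjInd_le_one (G := G) w v]

namespace IsRootedEigenvector

variable {V : Type*} [Fintype V] {G : SimpleGraph V} {lam : ℝ} {x : V → ℝ} {r : V}
  {U W : Finset V}

/-- Coordinates for a diamond `{a, b, c, d}`, where `e` indicates the edge `cd`: sums over the
diamond, its total charge, the eigenvalue equations, and the restrictions that `F₆`-freeness puts
on the neighbours of a vertex `w ∈ W`. -/
theorem diamond_coords (h : IsRootedEigenvector G lam x r U W) (hG : F6Free G) {B : Finset V}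
    (hB : IsDiamondIn G U B) :
    ∃ a b c d, ∃ e : ℝ, (e = 0 ∨ e = 1) ∧ B = {a, b, c, d} ∧
      (∀ f : V → ℝ, ∑ v ∈ B, f v = f a + f b + f c + f d) ∧
      (∑ v ∈ B, charge G U x v
        = 2 * (x a + x b) + (1 + e) * (x c + x d) - 5 - e) ∧
      (lam * x a = 1 + x b + x c + x d + ∑ w ∈ W, adjInd G w a * x w) ∧
      (lam * x b = 1 + x a + x c + x d + ∑ w ∈ W, adjInd G w b * x w) ∧
      (lam * x c = 1 + x a + x b + e * x d + ∑ w ∈ W, adjInd G w c * x w) ∧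
      (lam * x d = 1 + x a + x b + e * x c + ∑ w ∈ W, adjInd G w d * x w) ∧
      ∀ w ∈ W, adjInd G w a + adjInd G w b ≤ 1 ∧ adjInd G w a + adjInd G w c ≤ 1 ∧
        adjInd G w a + adjInd G w d ≤ 1 ∧ adjInd G w b + adjInd G w c ≤ 1 ∧
        adjInd G w b + adjInd G w d ≤ 1 ∧ e + adjInd G w c + adjInd G w d ≤ 2 := by
  have hadj := fun v (hv : v ∈ B) f => hB.sum_adjInd_mul hv f
  obtain ⟨⟨a, b, c, d, rfl, ab, ac, ad, bc, bd, cd⟩, hU, -⟩ := hB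
  have hsum : ∀ f : V → ℝ, ∑ v ∈ ({a, b, c, d} : Finset V), f v = f a + f b + f c + f d := by
    intro f
    rw [Finset.sum_insert (by simp [ab.ne, ac.ne, ad.ne]),
      Finset.sum_insert (by simp [bc.ne, bd.ne]), Finset.sum_insert (by simp [cd]),
      Finset.sum_singleton]
    ring
  have hmem : ∀ y, y ∈ ({a, b, c, d} : Finset V) → y ∈ U := fun y hy => hU hy
  have ha := hmem a (by simp)
  have hb := hmem b (by simp)
  have hc := hmem c (by simp)
  have hd := hmem d (by simp)
  have ra := (h.mem_U a).1 ha
  have rb := (h.mem_U b).1 hb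
  have rc := (h.mem_U c).1 hc
  have rd := (h.mem_U d).1 hd
  have loop : ∀ v, adjInd G v v = 0 := fun v => adjInd_of_not_adj (G.irrefl)
  have sa : ∀ f : V → ℝ, ∑ u ∈ U, adjInd G a u * f u = f b + f c + f d := fun f => by
    rw [hadj _ (by simp), hsum, loop, adjInd_of_adj ab, adjInd_of_adj ac, adjInd_of_adj ad]; ring
  have sb : ∀ f : V → ℝ, ∑ u ∈ U, adjInd G b u * f u = f a + f c + f d := fun f => by
    rw [hadj _ (by simp), hsum, loop, adjInd_of_adj ab.symm, adjInd_of_adj bc, adjInd_of_adj bd]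
    ring
  have sc : ∀ f : V → ℝ, ∑ u ∈ U, adjInd G c u * f u = f a + f b + adjInd G c d * f d :=
    fun f => by
    rw [hadj _ (by simp), hsum, loop, adjInd_of_adj ac.symm, adjInd_of_adj bc.symm]; ring
  have sd : ∀ f : V → ℝ, ∑ u ∈ U, adjInd G d u * f u = f a + f b + adjInd G c d * f c :=
    fun f => by
    rw [hadj _ (by simp), hsum, loop, adjInd_of_adj ad.symm, adjInd_of_adj bd.symm,
      adjInd_comm d c]; ring
  have da : degIn G U a = 3 := by
    simpa [degIn, show (1 + 1 + 1 : ℝ) = 3 by norm_num] using sa fun _ => 1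
  have db : degIn G U b = 3 := by
    simpa [degIn, show (1 + 1 + 1 : ℝ) = 3 by norm_num] using sb fun _ => 1
  have dc : degIn G U c = 2 + adjInd G c d := by
    simpa [degIn, show (1 + 1 : ℝ) = 2 by norm_num] using sc fun _ => 1
  have dd : degIn G U d = 2 + adjInd G c d := by
    simpa [degIn, show (1 + 1 : ℝ) = 2 by norm_num] using sd fun _ => 1
  have swap : ∀ v, ∑ w ∈ W, adjInd G w v * x w = ∑ w ∈ W, adjInd G v w * x w := fun v =>
    Finset.sum_congr rfl fun w _ => by rw [adjInd_comm]
  refine ⟨a, b, c, d, adjInd G c d, adjInd_eq_zero_or_one _ _, rfl, hsum, ?_, ?_, ?_, ?_, ?_, ?_⟩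
  · rw [hsum]
    simp only [charge, da, db, dc, dd]
    ring
  · rw [h.eigen_U ha, sa, swap]; ring
  · rw [h.eigen_U hb, sb, swap]; ring
  · rw [h.eigen_U hc, sc, swap]; ring
  · rw [h.eigen_U hd, sd, swap]; ring
  · intro w hw
    obtain ⟨hwr, hwn⟩ := (h.mem_W w).1 hw
    have na := hG.not_adj_of_diamond ra rb rc rd ab ac ad bc bd cd hwr hwn
    have nb := hG.not_adj_of_diamond rb ra rc rd ab.symm bc bd ac ad cd hwr hwn
    refine ⟨adjInd_add_le_one fun h => (na h).1, adjInd_add_le_one fun h => (na h).2.1,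
      adjInd_add_le_one fun h => (na h).2.2, adjInd_add_le_one fun h => (nb h).2.1,
      adjInd_add_le_one fun h => (nb h).2.2, ?_⟩
    by_cases hcd : G.Adj c d
    · have := adjInd_add_le_one (G := G) (w := w) (u := c) (v := d) fun h =>
        (hG.not_adj_of_diamond rc rd ra rb hcd ac.symm bc.symm ad.symm bd.symm ab.ne hwr hwn h).1
      rw [adjInd_of_adj hcd]
      linarith
    · have h1 := adjInd_le_one (G := G) w c
      have h2 := adjInd_le_one (G := G) w d
      rw [adjInd_of_not_adj hcd]
      linarith

/-- A vertex of `W` misses much of the weight of each diamond. -/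
theorem charge_add_one_le (h : IsRootedEigenvector G lam x r U W) (hG : F6Free G) {B : Finset V}
    (hB : IsDiamondIn G U B) {w : V} (hw : w ∈ W) :
    ∑ v ∈ B, charge G U x v + 1 ≤ ∑ v ∈ B, (1 - adjInd G w v) * x v ∧
      0 < ∑ v ∈ B, (1 - adjInd G w v) * x v := by
  obtain ⟨a, b, c, d, e, he, -, hsum, hch, -, -, -, -, hwc⟩ := h.diamond_coords hG hB
  obtain ⟨h1, h2, h3, h4, h5, h6⟩ := hwc w hw
  rw [hch, hsum]
  have := h.pos a; have := h.pos b; have := h.pos c; have := h.pos d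
  have := h.le_one a; have := h.le_one b; have := h.le_one c; have := h.le_one d
  rcases adjInd_eq_zero_or_one (G := G) w a with ea | ea <;>
  rcases adjInd_eq_zero_or_one (G := G) w b with eb | eb <;>
  rcases adjInd_eq_zero_or_one (G := G) w c with ec | ec <;>
  rcases adjInd_eq_zero_or_one (G := G) w d with ed | ed <;>
  rw [ea, eb] at h1 <;> rw [ea, ec] at h2 <;> rw [ea, ed] at h3 <;> rw [eb, ec] at h4 <;>
  rw [eb, ed] at h5 <;> rw [ec, ed] at h6 <;> rw [ea, eb, ec, ed] <;>
  rcases he with rfl | rfl <;> constructor <;> linarith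

/-- A diamond of charge at least `-1` has more than `lam` neighbours in `W`. -/
theorem lam_lt_card (h : IsRootedEigenvector G lam x r U W) (hG : F6Free G) (hlam : 9 < lam)
    {B : Finset V} (hB : IsDiamondIn G U B) (hc : -1 ≤ ∑ v ∈ B, charge G U x v) :
    lam < #{w ∈ W | ∃ v ∈ B, G.Adj w v} := by
  obtain ⟨a, b, c, d, e, he, hBe, -, hch, xa, xb, xc, xd, hwc⟩ := h.diamond_coords hG hB
  have hle : ∑ w ∈ W, (adjInd G w a + adjInd G w b
      + (1 + e) / 2 * (adjInd G w c + adjInd G w d)) * x w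
      ≤ #{w ∈ W | ∃ v ∈ B, G.Adj w v} := by
    rw [Finset.card_filter]
    push_cast
    refine Finset.sum_le_sum fun w hw => ?_
    split_ifs with hex
    · obtain ⟨h1, h2, h3, h4, h5, h6⟩ := hwc w hw
      have hx0 := h.pos w
      have hx1 := h.le_one w
      have : adjInd G w a + adjInd G w b + (1 + e) / 2 * (adjInd G w c + adjInd G w d) ≤ 1 := by
        rcases adjInd_eq_zero_or_one (G := G) w a with ea | ea <;>
        rcases adjInd_eq_zero_or_one (G := G) w b with eb | eb <;>
        rcases adjInd_eq_zero_or_one (G := G) w c with ec | ec <;>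
        rcases adjInd_eq_zero_or_one (G := G) w d with ed | ed <;>
        rw [ea, eb] at h1 <;> rw [ea, ec] at h2 <;> rw [ea, ed] at h3 <;> rw [eb, ec] at h4 <;>
        rw [eb, ed] at h5 <;> rw [ec, ed] at h6 <;> rw [ea, eb, ec, ed] <;>
        rcases he with rfl | rfl <;> linarith
      nlinarith
    · push Not at hex
      subst hBe
      rw [adjInd_of_not_adj (hex a (by simp)), adjInd_of_not_adj (hex b (by simp)),
        adjInd_of_not_adj (hex c (by simp)), adjInd_of_not_adj (hex d (by simp))]
      simp
  have heq : ∑ w ∈ W, (adjInd G w a + adjInd G w b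
      + (1 + e) / 2 * (adjInd G w c + adjInd G w d)) * x w
      = ∑ w ∈ W, adjInd G w a * x w + ∑ w ∈ W, adjInd G w b * x w
      + (1 + e) / 2 * (∑ w ∈ W, adjInd G w c * x w + ∑ w ∈ W, adjInd G w d * x w) := by
    rw [mul_add, Finset.mul_sum, Finset.mul_sum, ← Finset.sum_add_distrib,
      ← Finset.sum_add_distrib, ← Finset.sum_add_distrib]
    exact Finset.sum_congr rfl fun w _ => by ring
  refine lt_of_lt_of_le ?_ (heq ▸ hle)
  rw [hch] at hc
  have := h.le_one c; have := h.le_one d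
  rcases he with rfl | rfl
  · have := mul_nonneg (show 0 ≤ lam / 2 - 1 by linarith)
      (show 0 ≤ 2 * (x a + x b) + (x c + x d) - 4 by linarith)
    linarith
  · have := mul_nonneg (show 0 ≤ lam - 3 by linarith)
      (show 0 ≤ x a + x b + x c + x d - 5 / 2 by linarith)
    linarith

theorem missing_le (h : IsRootedEigenvector G lam x r U W) (hlam : 2 ≤ lam) {w : V}
    (hw : w ∈ W) (hd : 1 ≤ degIn G U w) :
    ∑ u ∈ U, (1 - adjInd G w u) * x u
      ≤ lam * (degIn G W w / 2 + degIn G U w * (1 - x w)) := by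
  have h1 := h.eigen_W hw
  have h2 := h.lam_eq
  have h3 : ∑ u ∈ W, adjInd G w u * x u ≤ degIn G W w :=
    Finset.sum_le_sum fun u _ => mul_le_of_le_one_right (adjInd_nonneg _ _) (h.le_one u)
  have h4 := degIn_nonneg (G := G) W w
  have h5 := h.le_one w
  simp only [sub_mul, one_mul, Finset.sum_sub_distrib]
  have h6 : lam * (1 - x w) ≤ lam * (degIn G U w * (1 - x w)) :=
    mul_le_mul_of_nonneg_left (le_mul_of_one_le_left (by linarith) hd) (by linarith)
  have h7 : 2 * (degIn G W w / 2) ≤ lam * (degIn G W w / 2) :=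
    mul_le_mul_of_nonneg_right hlam (by linarith)
  linarith

theorem pathFiveFreeOn (h : IsRootedEigenvector G lam x r U W) (hG : F6Free G) :
    PathFiveFreeOn G U := fun p₁ h₁ p₂ h₂ p₃ h₃ p₄ h₄ p₅ h₅ a b c d e f g i j k =>
  hG.not_fan ((h.mem_U p₁).1 h₁) ((h.mem_U p₂).1 h₂) ((h.mem_U p₃).1 h₃) ((h.mem_U p₄).1 h₄)
    ((h.mem_U p₅).1 h₅) a b c d e f g i j k

theorem not_isDiamondIn (h : IsRootedEigenvector G lam x r U W) (hG : F6Free G) (hlam : 9 < lam)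
    (hm : (G.edgeSet.ncard : ℝ) - 1 ≤ lam ^ 2 - lam) (B₀ : Finset V) : ¬ IsDiamondIn G U B₀ := by
  intro hB₀
  set D : Finset (Finset V) := {B ∈ U.powerset | IsDiamondIn G U B} with hD
  have hDm : ∀ B, B ∈ D ↔ IsDiamondIn G U B := fun B => by
    simp only [hD, Finset.mem_filter, Finset.mem_powerset, and_iff_right_iff_imp]
    exact fun h => h.2.1
  have hDne : D.Nonempty := ⟨B₀, (hDm B₀).2 hB₀⟩
  have hD1 : (1 : ℝ) ≤ #D := by exact_mod_cast hDne.card_pos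
  set Γ : ℝ := ∑ B ∈ D, ∑ v ∈ B, charge G U x v with hΓ
  set f : V → ℝ := fun w => degIn G W w / 2 + degIn G U w * (1 - x w) with hf
  have hf0 : ∀ w, 0 ≤ f w := fun w => add_nonneg (div_nonneg (degIn_nonneg _ _) (by norm_num))
    (mul_nonneg (degIn_nonneg _ _) (sub_nonneg.2 (h.le_one w)))
  have hfΓ : ∑ w ∈ W, f w ≤ Γ + 1 := by
    have h1 := h.sum_W_le hm
    have h2 := (h.pathFiveFreeOn hG).sum_charge_le h.pos h.le_one
    linarith
  have hf0' : 0 ≤ ∑ w ∈ W, f w := Finset.sum_nonneg fun w _ => hf0 w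
  obtain ⟨B, hB, hBc⟩ : ∃ B ∈ D, -1 ≤ ∑ v ∈ B, charge G U x v := by
    by_contra! hlt
    have := Finset.sum_lt_sum_of_nonempty hDne hlt
    simp only [Finset.sum_const, nsmul_eq_mul] at this
    linarith
  rw [hDm] at hB
  have hcard := h.lam_lt_card hG hlam hB hBc
  set N : Finset V := {w ∈ W | ∃ v ∈ B, G.Adj w v} with hN
  have hkey : ∀ w ∈ N, Γ + 1 ≤ lam * f w ∧ 0 < lam * f w := by
    intro w hw
    obtain ⟨hwW, v, hv, hwv⟩ := Finset.mem_filter.1 hw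
    have h1 : _ ≤ lam * f w := h.missing_le (by linarith) hwW (one_le_degIn (hB.2.1 hv) hwv)
    have hdis : Set.PairwiseDisjoint (D : Set (Finset V)) fun B => B :=
      fun B hB B' hB' hne => by
        rw [Function.onFun, Finset.disjoint_left]
        exact fun v hv hv' => hne (((hDm B).1 hB).eq_of_mem ((hDm B').1 hB') hv hv')
    have h2 : ∑ B ∈ D, ∑ u ∈ B, (1 - adjInd G w u) * x u
        ≤ ∑ u ∈ U, (1 - adjInd G w u) * x u := by
      rw [← Finset.sum_biUnion hdis]
      exact Finset.sum_le_sum_of_subset_of_nonneg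
        (Finset.biUnion_subset.2 fun B hB => ((hDm B).1 hB).2.1)
        fun u _ _ => mul_nonneg (sub_nonneg.2 (adjInd_le_one _ _)) (h.pos u).le
    have h3 : ∑ B ∈ D, (∑ v ∈ B, charge G U x v + 1)
        ≤ ∑ B ∈ D, ∑ u ∈ B, (1 - adjInd G w u) * x u :=
      Finset.sum_le_sum fun B hB => (h.charge_add_one_le hG ((hDm B).1 hB) hwW).1
    have h4 : 0 < ∑ B ∈ D, ∑ u ∈ B, (1 - adjInd G w u) * x u :=
      Finset.sum_pos (fun B hB => (h.charge_add_one_le hG ((hDm B).1 hB) hwW).2) hDne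
    rw [Finset.sum_add_distrib, Finset.sum_const, nsmul_eq_mul, mul_one] at h3
    constructor <;> linarith
  have hNne : N.Nonempty := by
    rw [← Finset.card_pos]
    exact_mod_cast (show (0 : ℝ) < #N by linarith)
  have hNW : lam * ∑ w ∈ N, f w ≤ lam * ∑ w ∈ W, f w :=
    mul_le_mul_of_nonneg_left (Finset.sum_le_sum_of_subset_of_nonneg (Finset.filter_subset _ _)
      fun w _ _ => hf0 w) (by linarith)
  rw [Finset.mul_sum] at hNW
  have h1 : 0 < ∑ w ∈ N, lam * f w := Finset.sum_pos (fun w hw => (hkey w hw).2) hNne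
  have h2 := Finset.sum_le_sum fun w hw => (hkey w hw).1
  rw [Finset.sum_const, nsmul_eq_mul] at h2
  have h3 : lam * ∑ w ∈ W, f w ≤ lam * (Γ + 1) :=
    mul_le_mul_of_nonneg_left hfΓ (by linarith)
  have h4 : 0 < Γ + 1 := pos_of_mul_pos_right (by linarith) (by linarith : 0 ≤ lam)
  have h5 : lam * (Γ + 1) < #N * (Γ + 1) := mul_lt_mul_of_pos_right hcard h4
  linarith

end IsRootedEigenvector

theorem stmt_14 
    {V : Type} [Fintype V] [DecidableEq V] (G : SimpleGraph V) [DecidableRel G.Adj]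
    (m : ℕ) (hm : 88 ≤ m)
    (hfree : F6Free G)
    (hcard : G.edgeSet.ncard = m)
    (hnoiso : ∀ v : V, ∃ w, G.Adj v w)
    (hmax : ∀ (n : ℕ) (G' : SimpleGraph (Fin n)), F6Free G' → G'.edgeSet.ncard = m →
      (∀ v, ∃ w, G'.Adj v w) → specRad G' ≤ specRad G)
    (lam : ℝ) (hlam : lam = specRad G)
    (hconn : G.Connected)
    (hlow : (1 + Real.sqrt (4 * (m : ℝ) - 3)) / 2 ≤ lam)
    (x : V → ℝ) (hxpos : ∀ v, 0 < x v)
    (heig : (G.adjMatrix ℝ).mulVec x = lam • x)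
    (ustar : V) (hustar : ∀ v, x v ≤ x ustar)
    :
    ∀ C : (G.induce (G.neighborSet ustar)).ConnectedComponent,
      ¬ Nonempty ((G.induce (Subtype.val '' C.supp)) ≃g K4MinusE) := by
  rintro C ⟨φ⟩
  have hr := hxpos ustar
  have hs : Real.sqrt (4 * (m : ℝ) - 3) ^ 2 = 4 * m - 3 := Real.sq_sqrt (by
    have : (88 : ℝ) ≤ m := by exact_mod_cast hm
    linarith)
  have hm' : (88 : ℝ) ≤ m := by exact_mod_cast hm
  have hs0 := Real.sqrt_nonneg (4 * (m : ℝ) - 3)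
  have hlam9 : 9 < lam := by nlinarith
  have hedge : (G.edgeSet.ncard : ℝ) - 1 ≤ lam ^ 2 - lam := by
    rw [hcard]
    nlinarith
  have hroot : IsRootedEigenvector G lam (fun v => x v / x ustar) ustar
      {v | G.Adj ustar v} {v | v ≠ ustar ∧ ¬ G.Adj ustar v} := by
    refine ⟨fun v => div_pos (hxpos v) hr, fun v => (div_le_one hr).2 (hustar v),
      div_self hr.ne', fun v => ?_, by simp, by simp⟩
    have h1 := congrFun heig v
    simp only [Matrix.mulVec, dotProduct, Pi.smul_apply, smul_eq_mul,
      SimpleGraph.adjMatrix_apply] at h1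
    rw [← mul_div_assoc, ← h1, Finset.sum_div]
    refine Finset.sum_congr rfl fun u _ => ?_
    rw [mul_div_assoc, adjInd]
    congr
  set S : Set V := Subtype.val '' C.supp with hS
  have hadj : ∀ i j, K4MinusE.Adj i j → G.Adj (φ.symm i : V) (φ.symm j) := fun i j hij =>
    φ.symm.map_rel_iff.2 hij
  have hmem : ∀ v, v ∈ S ↔ v = φ.symm 2 ∨ v = φ.symm 3 ∨ v = φ.symm 0 ∨ v = φ.symm 1 := by
    intro v
    constructor
    · intro hv
      have hv' : v = φ.symm (φ ⟨v, hv⟩) := by simp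
      generalize φ ⟨v, hv⟩ = i at hv'
      fin_cases i <;> simp_all
    · rintro (rfl | rfl | rfl | rfl) <;> exact Subtype.coe_prop _
  obtain ⟨B, hB⟩ : ∃ B, IsDiamondIn G {v | G.Adj ustar v} B := by
    refine exists_isDiamondIn_of_coords (hadj 2 3 ?_) (hadj 2 0 ?_) (hadj 2 1 ?_) (hadj 3 0 ?_)
      (hadj 3 1 ?_) ?_ ?_ ?_
    · simp [K4MinusE]
    · simp [K4MinusE]
    · simp [K4MinusE]
    · simp [K4MinusE]
    · simp [K4MinusE]
    · intro he
      have := φ.symm.injective (Subtype.ext he)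
      simp at this
    · intro v hv
      obtain ⟨y, -, rfl⟩ := (hmem v).2 hv
      exact Finset.mem_filter.2 ⟨Finset.mem_univ _, y.2⟩
    · intro v hv u hu hvu
      obtain ⟨y, hy, rfl⟩ := (hmem v).2 hv
      have huU : u ∈ G.neighborSet ustar := by simpa using hu
      refine (hmem u).1 ⟨⟨u, huU⟩, ?_, rfl⟩
      rw [SimpleGraph.ConnectedComponent.mem_supp_iff] at hy ⊢
      rw [← hy]
      exact SimpleGraph.ConnectedComponent.sound
        (SimpleGraph.Adj.reachable (G := G.induce (G.neighborSet ustar)) (u := ⟨u, huU⟩) (v := y) hvu.symm)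
  exact hroot.not_isDiamondIn hfree hlam9 hedge B hB
end
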